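/- arXiv:2402.07424 — 7 statements merged into one kernel-verified Lean document; each statement's English description precedes it below -/
import Mathlib

section
/- Fix integers k ≥ 1 and n ≥ 1. Then the principal specialization of the stable Grothendieck polynomial for the single-row partition (k) satisfies, as an identity of polynomials in β over ℚ: Σ_{T ∈ SVT((k), n)} β^{|T| − k} = C(n+k−1, k) · Σ_{m=0}^{n−1} (k/(k+m)) · C(n−1, m) · β^m. (The right-hand side is C(n+k−1,k) times the terminating Gauss hypergeometric series ₂F₁(k, 1−n; k+1; −β).) -/
open Finset

/-- The set of boxes of the Young diagram of `lam` within the first `n` rows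
(rows indexed `0, …, n-1`; box `(i,j)` is present iff `j < lam i`). -/
def youngCells (n : ℕ) (lam : ℕ → ℕ) : Finset (ℕ × ℕ) :=
  (Finset.range n).biUnion fun i => {i} ×ˢ Finset.range (lam i)

/-- Set-valued tableaux of shape `lam` with entries in `{1, …, n}`, encoded as finite
sets of pairs (box, entry): the nonempty set assigned to a box `p` is `{e | (p, e) ∈ T}`.
The conditions say: every box of the diagram gets at least one entry; all entries lie in
`{1, …, n}`; entries weakly increase along rows (`max T_{i,j} ≤ min T_{i,j+1}`) and
strictly increase down columns (`max T_{i,j} < min T_{i+1,j}`).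
For a tableau `T`, the total number of assigned entries `|T|` is `T.card`. -/
def SVT (n : ℕ) (lam : ℕ → ℕ) : Finset (Finset ((ℕ × ℕ) × ℕ)) :=
  ((youngCells n lam) ×ˢ Finset.Icc 1 n).powerset.filter fun T =>
    (∀ p ∈ youngCells n lam, ∃ x ∈ T, x.1 = p) ∧
    (∀ x ∈ T, ∀ y ∈ T, x.1.1 = y.1.1 → x.1.2 + 1 = y.1.2 → x.2 ≤ y.2) ∧
    (∀ x ∈ T, ∀ y ∈ T, x.1.1 + 1 = y.1.1 → x.1.2 = y.1.2 → x.2 < y.2)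

/-- Predicate form of set-valued tableaux of a single row. -/
def IsRow (k n : ℕ) (T : Finset ((ℕ × ℕ) × ℕ)) : Prop :=
  (∀ i j e, ((i, j), e) ∈ T → i = 0 ∧ j < k ∧ 1 ≤ e ∧ e ≤ n) ∧
  (∀ j, j < k → ∃ e, ((0, j), e) ∈ T) ∧
  (∀ j e f, ((0, j), e) ∈ T → ((0, j + 1), f) ∈ T → e ≤ f)

open Classical in
/-- The finset of single-row set-valued tableaux. -/
noncomputable def rowSet (k n : ℕ) : Finset (Finset ((ℕ × ℕ) × ℕ)) :=
  ((({0} : Finset ℕ) ×ˢ range k) ×ˢ Icc 1 n).powerset.filter (IsRow k n)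

lemma mem_rowSet (k n : ℕ) (T) : T ∈ rowSet k n ↔ IsRow k n T := by
  classical
  unfold rowSet
  rw [mem_filter, and_iff_right_iff_imp]
  intro h
  rw [mem_powerset]
  rintro ⟨⟨i, j⟩, e⟩ hx
  have := h.1 i j e hx
  simp only [mem_product, mem_singleton, mem_range, mem_Icc]
  omega

lemma mem_cells (k n : ℕ) (hn : 1 ≤ n) (i j : ℕ) :
    (i, j) ∈ youngCells n (fun i => if i = 0 then k else 0) ↔ i = 0 ∧ j < k := by
  simp only [youngCells, mem_biUnion, mem_product, mem_singleton, mem_range]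
  constructor
  · rintro ⟨a, ha, rfl, h⟩
    split_ifs at h with h0
    · exact ⟨h0, h⟩
    · omega
  · rintro ⟨rfl, h⟩
    exact ⟨0, by omega, rfl, by simpa using h⟩

lemma SVT_eq (k n : ℕ) (hn : 1 ≤ n) :
    SVT n (fun i => if i = 0 then k else 0) = rowSet k n := by
  ext T
  rw [mem_rowSet]
  unfold SVT IsRow
  rw [mem_filter, mem_powerset]
  constructor
  · rintro ⟨h0, h1, h2, -⟩
    refine ⟨?_, ?_, ?_⟩
    · intro i j e h
      have := h0 h
      rw [mem_product, mem_cells k n hn, mem_Icc] at this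
      simp only at this
      omega
    · intro j hj
      obtain ⟨⟨p, e⟩, hx, rfl⟩ := h1 (0, j) ((mem_cells k n hn _ _).2 ⟨rfl, hj⟩)
      exact ⟨e, hx⟩
    · intro j e f h h'
      exact h2 _ h _ h' rfl rfl
  · rintro ⟨h0, h1, h2⟩
    refine ⟨?_, ?_, ?_, ?_⟩
    · rintro ⟨⟨i, j⟩, e⟩ h
      have := h0 _ _ _ h
      rw [mem_product, mem_cells k n hn, mem_Icc]
      simp only
      omega
    · rintro ⟨i, j⟩ h
      rw [mem_cells k n hn] at h
      obtain ⟨rfl, hj⟩ := h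
      obtain ⟨e, he⟩ := h1 j hj
      exact ⟨_, he, rfl⟩
    · rintro ⟨⟨i, j⟩, e⟩ hx ⟨⟨i', j'⟩, f⟩ hy h h'
      simp only at h h'
      have := (h0 _ _ _ hx).1
      subst h h' this
      exact h2 _ _ _ hx hy
    · rintro ⟨⟨i, j⟩, e⟩ hx ⟨⟨i', j'⟩, f⟩ hy h h'
      have := h0 _ _ _ hx
      have := h0 _ _ _ hy
      simp only at h
      omega

lemma IsRow.mono {k n : ℕ} {T} (h : IsRow k n T) (d : ℕ) :
    ∀ i e f, ((0, i), e) ∈ T → ((0, i + d + 1), f) ∈ T → e ≤ f := by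
  induction d with
  | zero => intro i e f; exact h.2.2 i e f
  | succ d ih =>
    intro i e f he hf
    obtain ⟨g, hg⟩ := h.2.1 (i + d + 1) (by have := h.1 _ _ _ hf; omega)
    exact (ih _ _ _ he hg).trans (h.2.2 _ _ _ hg hf)

lemma IsRow.le_last {k n : ℕ} {T} (h : IsRow (k + 1) n T) {i j e f : ℕ}
    (he : ((i, j), e) ∈ T) (hf : ((0, k), f) ∈ T) (hj : j ≠ k) : e ≤ f := by
  obtain ⟨rfl, hj', -⟩ := h.1 _ _ _ he
  refine h.mono (k - j - 1) j e f he ?_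
  rwa [show j + (k - j - 1) + 1 = k by omega]

lemma card_ge {k n : ℕ} {T} (h : IsRow k n T) : k ≤ T.card := by
  have : range k ⊆ T.image (fun x => x.1.2) := by
    intro j hj
    obtain ⟨e, he⟩ := h.2.1 j (mem_range.1 hj)
    exact mem_image.2 ⟨_, he, rfl⟩
  calc k = (range k).card := by simp
    _ ≤ _ := card_le_card this
    _ ≤ _ := card_image_le

lemma row_notMem1 {k n : ℕ} {T} (h : IsRow k n T) (j : ℕ) : ((0, j), n + 1) ∉ T := by
  intro h'
  have := h.1 _ _ _ h'
  omega

lemma row_notMem2 {k n : ℕ} {T} (h : IsRow k n T) (e : ℕ) : ((0, k), e) ∉ T := by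
  intro h'
  have := h.1 _ _ _ h'
  omega

lemma row_up {k n : ℕ} {T} (h : IsRow k n T) : IsRow k (n + 1) T :=
  ⟨fun i j e he => by have := h.1 _ _ _ he; omega, h.2⟩

lemma row_ins1 {k n : ℕ} {T} (h : IsRow (k + 1) n T) :
    IsRow (k + 1) (n + 1) (insert ((0, k), n + 1) T) := by
  refine ⟨?_, ?_, ?_⟩
  · intro i j e he
    rw [mem_insert] at he
    rcases he with he | he
    · simp only [Prod.mk.injEq] at he; omega
    · have := h.1 _ _ _ he; omega
  · intro j hj
    obtain ⟨e, he⟩ := h.2.1 j hj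
    exact ⟨e, mem_insert_of_mem he⟩
  · intro j e f he hf
    rw [mem_insert] at he hf
    rcases he with he | he <;> rcases hf with hf | hf
    · simp only [Prod.mk.injEq] at he hf; omega
    · have := h.1 _ _ _ hf
      simp only [Prod.mk.injEq] at he; omega
    · have := h.1 _ _ _ he
      simp only [Prod.mk.injEq] at hf; omega
    · exact h.2.2 _ _ _ he hf

lemma row_ins2 {k n : ℕ} {T} (h : IsRow k (n + 1) T) :
    IsRow (k + 1) (n + 1) (insert ((0, k), n + 1) T) := by
  refine ⟨?_, ?_, ?_⟩
  · intro i j e he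
    rw [mem_insert] at he
    rcases he with he | he
    · simp only [Prod.mk.injEq] at he; omega
    · have := h.1 _ _ _ he; omega
  · intro j hj
    by_cases hjk : j = k
    · subst hjk
      exact ⟨n + 1, mem_insert_self _ _⟩
    · obtain ⟨e, he⟩ := h.2.1 j (by omega)
      exact ⟨e, mem_insert_of_mem he⟩
  · intro j e f he hf
    rw [mem_insert] at he hf
    rcases he with he | he <;> rcases hf with hf | hf
    · simp only [Prod.mk.injEq] at he hf; omega
    · have := h.1 _ _ _ hf
      simp only [Prod.mk.injEq] at he; omega
    · have := h.1 _ _ _ he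
      simp only [Prod.mk.injEq] at hf; omega
    · exact h.2.2 _ _ _ he hf

lemma row_cases {k n : ℕ} {T} (h : IsRow (k + 1) (n + 1) T) :
    IsRow (k + 1) n T ∨ ∃ S, (IsRow (k + 1) n S ∨ IsRow k (n + 1) S) ∧
      insert ((0, k), n + 1) S = T := by
  by_cases ha : ((0, k), n + 1) ∈ T
  · right
    refine ⟨T.erase ((0, k), n + 1), ?_, insert_erase ha⟩
    by_cases hb : ∃ f, f ≠ n + 1 ∧ ((0, k), f) ∈ T
    · obtain ⟨f, hf, hfT⟩ := hb
      left
      have hfn := h.1 _ _ _ hfT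
      refine ⟨?_, ?_, ?_⟩
      · intro i j e he
        rw [mem_erase] at he
        have h1 := h.1 _ _ _ he.2
        refine ⟨h1.1, h1.2.1, h1.2.2.1, ?_⟩
        by_cases hj : j = k
        · have : e ≠ n + 1 := by
            rintro rfl
            exact he.1 (by rw [h1.1, hj])
          omega
        · have := h.le_last he.2 hfT hj
          omega
      · intro j hj
        by_cases hjk : j = k
        · subst hjk
          exact ⟨f, mem_erase.2 ⟨by simp [hf], hfT⟩⟩
        · obtain ⟨e, he⟩ := h.2.1 j hj
          exact ⟨e, mem_erase.2 ⟨by simp [hjk], he⟩⟩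
      · intro j e f he hf
        exact h.2.2 _ _ _ (mem_of_mem_erase he) (mem_of_mem_erase hf)
    · right
      push Not at hb
      refine ⟨?_, ?_, ?_⟩
      · intro i j e he
        rw [mem_erase] at he
        have h1 := h.1 _ _ _ he.2
        refine ⟨h1.1, ?_, h1.2.2⟩
        have : j ≠ k := by
          rintro rfl
          have h0 := h1.1
          subst h0
          refine hb e ?_ he.2
          rintro rfl
          exact he.1 rfl
        omega
      · intro j hj
        obtain ⟨e, he⟩ := h.2.1 j (by omega)
        exact ⟨e, mem_erase.2 ⟨by simp [hj.ne], he⟩⟩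
      · intro j e f he hf
        exact h.2.2 _ _ _ (mem_of_mem_erase he) (mem_of_mem_erase hf)
  · left
    refine ⟨?_, h.2⟩
    intro i j e he
    have h1 := h.1 _ _ _ he
    refine ⟨h1.1, h1.2.1, h1.2.2.1, ?_⟩
    obtain ⟨f, hf⟩ := h.2.1 k (by omega)
    have h2 := h.1 _ _ _ hf
    have : f ≠ n + 1 := by rintro rfl; exact ha hf
    by_cases hj : j = k
    · have : e ≠ n + 1 := by
        rintro rfl
        rw [h1.1, hj] at he
        exact ha he
      omega
    · have := h.le_last he hf hj
      omega

open Polynomial in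
/-- Generating polynomial by number of entries. -/
noncomputable def rowGen (k n : ℕ) : ℚ[X] := ∑ T ∈ rowSet k n, X ^ T.card

lemma rowGen_rec (k n : ℕ) : rowGen (k + 1) (n + 1) =
    rowGen (k + 1) n + rowGen (k + 1) n * Polynomial.X + rowGen k (n + 1) * Polynomial.X := by
  classical
  have hdis : Disjoint (rowSet (k + 1) n) (rowSet k (n + 1)) := by
    rw [disjoint_left]
    intro T h1 h2
    rw [mem_rowSet] at h1 h2
    obtain ⟨e, he⟩ := h1.2.1 k (by omega)
    exact row_notMem2 h2 e he
  have hnot : ∀ S ∈ (rowSet (k + 1) n) ∪ (rowSet k (n + 1)), ((0, k), n + 1) ∉ S := by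
    intro S hS
    rw [mem_union, mem_rowSet, mem_rowSet] at hS
    rcases hS with hS | hS
    · exact row_notMem1 hS k
    · exact row_notMem2 hS _
  have heq : rowSet (k + 1) (n + 1) = rowSet (k + 1) n ∪
      ((rowSet (k + 1) n) ∪ (rowSet k (n + 1))).image (insert ((0, k), n + 1)) := by
    ext T
    simp only [mem_union, mem_image, mem_rowSet]
    constructor
    · exact row_cases
    · rintro (h | ⟨S, h | h, rfl⟩)
      · exact row_up h
      · exact row_ins1 h
      · exact row_ins2 h
  have hdis2 : Disjoint (rowSet (k + 1) n)
      (((rowSet (k + 1) n) ∪ (rowSet k (n + 1))).image (insert ((0, k), n + 1))) := by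
    rw [disjoint_left]
    intro T h1 h2
    rw [mem_rowSet] at h1
    obtain ⟨S, -, rfl⟩ := mem_image.1 h2
    exact row_notMem1 h1 k (mem_insert_self _ _)
  have hsum : ∑ S ∈ (rowSet (k + 1) n) ∪ (rowSet k (n + 1)),
      (Polynomial.X : Polynomial ℚ) ^ (insert ((0, k), n + 1) S).card =
      ∑ S ∈ (rowSet (k + 1) n) ∪ (rowSet k (n + 1)),
      (Polynomial.X : Polynomial ℚ) ^ S.card * Polynomial.X :=
    sum_congr rfl (fun S hS => by rw [card_insert_of_notMem (hnot S hS), pow_succ])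
  unfold rowGen
  rw [heq, sum_union hdis2, sum_image, hsum, sum_union hdis,
    sum_mul, sum_mul, add_assoc]
  intro S hS S' hS' h
  have := congrArg (fun U => erase U ((0, k), n + 1)) h
  simpa [erase_insert (hnot S hS), erase_insert (hnot S' hS')] using this

lemma rowGen_zero (n : ℕ) : rowGen 0 n = 1 := by
  have : rowSet 0 n = {∅} := by
    ext T
    rw [mem_rowSet, mem_singleton]
    constructor
    · intro h
      rw [eq_empty_iff_forall_notMem]
      rintro ⟨⟨i, j⟩, e⟩ he
      have := h.1 _ _ _ he
      omega
    · rintro rfl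
      simp [IsRow]
  simp [rowGen, this]

lemma rowGen_zero' (k : ℕ) : rowGen (k + 1) 0 = 0 := by
  have : rowSet (k + 1) 0 = ∅ := by
    rw [eq_empty_iff_forall_notMem]
    intro T h
    rw [mem_rowSet] at h
    obtain ⟨e, he⟩ := h.2.1 0 (by omega)
    have := h.1 _ _ _ he
    omega
  simp [rowGen, this]

lemma coeff_rowGen (k n : ℕ) : (rowGen (k + 1) n).coeff 0 = 0 ∧ ∀ t,
    (rowGen (k + 1) n).coeff (t + 1) = ((n + k).choose (t + 1) * t.choose k : ℕ) := by
  induction k generalizing n with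
  | zero =>
    induction n with
    | zero => simp [rowGen_zero']
    | succ n ih =>
      rw [rowGen_rec, rowGen_zero]
      refine ⟨by simp [ih.1], fun t => ?_⟩
      rw [Polynomial.coeff_add, Polynomial.coeff_add, Polynomial.coeff_mul_X,
        Polynomial.coeff_mul_X, ih.2]
      cases t with
      | zero => simp [ih.1]
      | succ t =>
        rw [ih.2, Polynomial.coeff_one]
        simp [Nat.choose_succ_succ n (t + 1)]
        ring
  | succ k ihk =>
    induction n with
    | zero =>
      refine ⟨by simp [rowGen_zero'], fun t => ?_⟩
      rw [rowGen_zero']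
      rcases lt_or_ge t (k + 1) with h | h
      · simp [Nat.choose_eq_zero_of_lt h]
      · rw [Nat.choose_eq_zero_of_lt (show 0 + (k + 1) < t + 1 by omega)]
        simp
    | succ n ih =>
      rw [rowGen_rec]
      refine ⟨by simp [ih.1], fun t => ?_⟩
      rw [Polynomial.coeff_add, Polynomial.coeff_add, Polynomial.coeff_mul_X,
        Polynomial.coeff_mul_X, ih.2]
      cases t with
      | zero => simp [ih.1, (ihk _).1]
      | succ t =>
        rw [ih.2, (ihk _).2]
        rw [show n + 1 + (k + 1) = (n + (k + 1)) + 1 by ring,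
          Nat.choose_succ_succ (n + (k + 1)) (t + 1), Nat.choose_succ_succ t k,
          show n + 1 + k = n + (k + 1) by ring]
        push_cast
        ring

lemma choose_id (k n m : ℕ) : (((n + 1 + k).choose (k + m + 1) * (k + m).choose k : ℕ) : ℚ) =
    ((n + 1 + (k + 1) - 1).choose (k + 1) : ℚ) *
      (((k + 1 : ℕ) : ℚ) / (((k + 1 : ℕ) : ℚ) + (m : ℚ)) * ((n.choose m : ℕ) : ℚ)) := by
  have h1 : (n + 1 + k).choose (k + m + 1) * (k + m + 1).choose (k + 1) =
      (n + 1 + k).choose (k + 1) * n.choose m := by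
    rcases lt_or_ge n m with h | h
    · rw [Nat.choose_eq_zero_of_lt h, Nat.choose_eq_zero_of_lt (show n + 1 + k < k + m + 1 by omega)]
      simp
    · have := Nat.choose_mul (n := n + 1 + k) (k := k + m + 1) (s := k + 1) (by omega)
      rw [this]
      congr 2 <;> omega
  have h2 := Nat.add_one_mul_choose_eq (k + m) k
  have h3 : ((k : ℚ) + 1 + m) ≠ 0 := by positivity
  rw [show n + 1 + (k + 1) - 1 = n + 1 + k by omega]
  have h1' := congrArg (Nat.cast (R := ℚ)) h1
  have h2' := congrArg (Nat.cast (R := ℚ)) h2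
  push_cast at h1' h2' ⊢
  field_simp
  linear_combination ((n + 1 + k).choose (k + m + 1) : ℚ) * h2' + ((k : ℚ) + 1) * h1'

/-- For `k, n ≥ 1`, the principal specialization of the stable
Grothendieck polynomial of the single-row partition `(k)` satisfies, as an identity
of polynomials in `β` over `ℚ`:
`Σ_{T ∈ SVT((k),n)} β^(|T|-k) = C(n+k-1,k) · Σ_{m=0}^{n-1} (k/(k+m)) C(n-1,m) β^m`. -/
theorem grothendieck_single_row (k n : ℕ) (hk : 1 ≤ k) (hn : 1 ≤ n) :
    ∑ T ∈ SVT n (fun i => if i = 0 then k else 0), (Polynomial.X : Polynomial ℚ) ^ (T.card - k)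
      = Polynomial.C (((n + k - 1).choose k : ℚ)) *
        ∑ m ∈ Finset.range n,
          Polynomial.C ((k : ℚ) / ((k : ℚ) + (m : ℚ)) * (((n - 1).choose m : ℚ))) *
            Polynomial.X ^ m := by
  rw [SVT_eq k n hn]
  obtain ⟨k, rfl⟩ : ∃ k', k = k' + 1 := ⟨k - 1, by omega⟩
  obtain ⟨n, rfl⟩ : ∃ n', n = n' + 1 := ⟨n - 1, by omega⟩
  have hX : (Polynomial.X : Polynomial ℚ) ^ (k + 1) ≠ 0 := pow_ne_zero _ Polynomial.X_ne_zero
  apply mul_right_cancel₀ hX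
  have hL : (∑ T ∈ rowSet (k + 1) (n + 1), (Polynomial.X : Polynomial ℚ) ^ (T.card - (k + 1))) *
      Polynomial.X ^ (k + 1) = rowGen (k + 1) (n + 1) := by
    rw [rowGen, sum_mul]
    refine sum_congr rfl fun T hT => ?_
    rw [← pow_add, Nat.sub_add_cancel (card_ge ((mem_rowSet _ _ _).1 hT))]
  rw [hL]
  ext t
  rw [Polynomial.coeff_mul_X_pow']
  split_ifs with h
  · obtain ⟨m, rfl⟩ := Nat.exists_eq_add_of_le h
    rw [show k + 1 + m = k + m + 1 by ring, (coeff_rowGen _ _).2, Polynomial.coeff_C_mul,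
      Polynomial.finset_sum_coeff, choose_id, show k + m + 1 - (k + 1) = m by omega]
    congr 1
    simp only [Polynomial.coeff_C_mul_X_pow, Finset.sum_ite_eq, mem_range]
    split_ifs with hm
    · simp
    · rw [Nat.choose_eq_zero_of_lt (by omega)]
      simp
  · cases t with
    | zero => exact (coeff_rowGen _ _).1
    | succ t =>
      rw [(coeff_rowGen _ _).2, Nat.choose_eq_zero_of_lt (show t < k by omega)]
      simp
end

section
/- Fix integers n ≥ 1 and 1 ≤ k ≤ n. Then the principal specialization of the stable Grothendieck polynomial for the single-column partition (1^k) satisfies, as an identity of polynomials in β over ℚ: Σ_{T ∈ SVT((1^k), n)} β^{|T| − k} = C(n, k) · Σ_{m=0}^{n−k} (k/(k+m)) · C(n−k, m) · β^m. (The right-hand side is C(n,k) times the terminating Gauss hypergeometric series ₂F₁(k, k−n; k+1; −β).) -/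
open Finset

/-- Validity of a single column set-valued tableau. -/
def ColValid (N k : ℕ) (T : Finset ((ℕ × ℕ) × ℕ)) : Prop :=
  (∀ i j e, ((i, j), e) ∈ T → i < k ∧ j = 0 ∧ 1 ≤ e ∧ e ≤ N) ∧
  (∀ i, i < k → ∃ e, ((i, 0), e) ∈ T) ∧
  (∀ i e i' e', ((i, 0), e) ∈ T → ((i', 0), e') ∈ T → i < i' → e < e')

/-- Recursive enumeration of single column set-valued tableaux. -/
def colS : ℕ → ℕ → Finset (Finset ((ℕ × ℕ) × ℕ))
  | _, 0 => {∅}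
  | 0, _ + 1 => ∅
  | N + 1, k + 1 => colS N (k + 1) ∪
      (colS N (k + 1) ∪ colS N k).image (insert ((k, 0), N + 1))

lemma mem_colS (N k : ℕ) (T : Finset ((ℕ × ℕ) × ℕ)) : T ∈ colS N k ↔ ColValid N k T := by
  induction N generalizing k T with
  | zero =>
    cases k with
    | zero =>
      simp only [colS, mem_singleton, ColValid]
      constructor
      · rintro rfl; simp
      · rintro ⟨h, -, -⟩
        apply Finset.eq_empty_of_forall_notMem
        rintro ⟨⟨i, j⟩, e⟩ hx
        have := h i j e hx
        omega
    | succ k =>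
      simp only [colS, notMem_empty, ColValid, false_iff]
      rintro ⟨h, h2, -⟩
      obtain ⟨e, he⟩ := h2 0 (by omega)
      have := h _ _ _ he
      omega
  | succ N ih =>
    cases k with
    | zero =>
      simp only [colS, mem_singleton, ColValid]
      constructor
      · rintro rfl; simp
      · rintro ⟨h, -, -⟩
        apply Finset.eq_empty_of_forall_notMem
        rintro ⟨⟨i, j⟩, e⟩ hx
        have := h i j e hx
        omega
    | succ k =>
      simp only [colS, mem_union, mem_image, ih]
      constructor
      · rintro (⟨h1, h2, h3⟩ | ⟨U, (⟨h1, h2, h3⟩ | ⟨h1, h2, h3⟩), rfl⟩)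
        · refine ⟨fun i j e h => ?_, h2, h3⟩
          have := h1 i j e h
          omega
        all_goals
          refine ⟨fun i j e h => ?_, fun i hi => ?_, fun i e i' e' h h' hlt => ?_⟩
          · simp only [mem_insert, Prod.mk.injEq] at h
            rcases h with h | h
            · omega
            · have := h1 i j e h
              omega
          · by_cases hik : i = k
            · exact ⟨N + 1, by simp [hik]⟩
            · obtain ⟨e, he⟩ := h2 i (by omega)
              exact ⟨e, mem_insert_of_mem he⟩
          · simp only [mem_insert, Prod.mk.injEq] at h h'
            rcases h with h | h <;> rcases h' with h' | h'
            · omega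
            · have := h1 _ _ _ h'
              omega
            · have := h1 _ _ _ h
              omega
            · exact h3 _ _ _ _ h h' hlt
      · rintro ⟨h1, h2, h3⟩
        by_cases hm : ((k, 0), N + 1) ∈ T
        · right
          refine ⟨T.erase ((k, 0), N + 1), ?_, insert_erase hm⟩
          have hE : ∀ i j e, ((i, j), e) ∈ T.erase ((k, 0), N + 1) →
              i < k + 1 ∧ j = 0 ∧ 1 ≤ e ∧ e ≤ N := by
            intro i j e h
            simp only [mem_erase, ne_eq, Prod.mk.injEq] at h
            have a := h1 _ _ _ h.2
            obtain ⟨_, rfl, _⟩ := a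
            by_cases hik : i = k
            · omega
            · have := h3 _ _ _ _ h.2 hm (by omega)
              omega
          have h3' : ∀ i e i' e', ((i, 0), e) ∈ T.erase ((k, 0), N + 1) →
              ((i', 0), e') ∈ T.erase ((k, 0), N + 1) → i < i' → e < e' :=
            fun i e i' e' h h' => h3 _ _ _ _ (mem_of_mem_erase h) (mem_of_mem_erase h')
          have h2' : ∀ i, i < k → ∃ e, ((i, 0), e) ∈ T.erase ((k, 0), N + 1) := by
            intro i hi
            obtain ⟨e, he⟩ := h2 i (by omega)
            refine ⟨e, mem_erase.2 ⟨?_, he⟩⟩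
            simp only [ne_eq, Prod.mk.injEq]
            omega
          by_cases hr : ∃ e, ((k, 0), e) ∈ T.erase ((k, 0), N + 1)
          · left
            refine ⟨hE, fun i hi => ?_, h3'⟩
            by_cases hik : i = k
            · rw [hik]; exact hr
            · exact h2' i (by omega)
          · right
            refine ⟨fun i j e h => ?_, h2', h3'⟩
            have a := hE _ _ _ h
            obtain ⟨_, rfl, _⟩ := a
            have : i ≠ k := by
              rintro rfl
              exact hr ⟨e, h⟩
            omega
        · left
          refine ⟨fun i j e h => ?_, h2, h3⟩
          have a := h1 _ _ _ h
          obtain ⟨_, rfl, _⟩ := a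
          have : e ≠ N + 1 := by
            rintro rfl
            by_cases hik : i = k
            · subst hik; exact hm h
            · obtain ⟨e', he'⟩ := h2 k (by omega)
              have := h3 _ _ _ _ h he' (by omega)
              have := h1 _ _ _ he'
              omega
          omega

open Polynomial in
/-- generating polynomial -/
noncomputable def colP (N k : ℕ) : Polynomial ℚ := ∑ T ∈ colS N k, (X : Polynomial ℚ) ^ T.card

lemma notMem_colS {N k a b : ℕ} {T : Finset ((ℕ × ℕ) × ℕ)} (h : T ∈ colS N k) :
    ((a, b), N + 1) ∉ T := by
  intro h'
  have := ((mem_colS _ _ _).1 h).1 _ _ _ h'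
  omega

open Polynomial in
lemma colP_succ (N k : ℕ) :
    colP (N + 1) (k + 1) = colP N (k + 1) + X * (colP N (k + 1) + colP N k) := by
  have key : ∀ U ∈ colS N (k + 1) ∪ colS N k, ((k, 0), N + 1) ∉ U := by
    intro U hU
    rcases mem_union.1 hU with h | h <;> exact notMem_colS h
  unfold colP
  rw [colS, sum_union, sum_image, ← sum_union, mul_sum]
  · congr 1
    apply sum_congr rfl
    intro U hU
    rw [card_insert_of_notMem (key U hU), pow_succ']
  · rw [disjoint_left]
    intro U h h'
    rw [mem_colS] at h h'
    obtain ⟨e, he⟩ := h.2.1 k (by omega)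
    have := h'.1 _ _ _ he
    omega
  · intro U hU V hV h
    have := congrArg (fun W => W.erase ((k, 0), N + 1)) h
    simpa [erase_insert (key U hU), erase_insert (key V hV)] using this
  · rw [disjoint_left]
    intro U h h'
    obtain ⟨V, -, rfl⟩ := mem_image.1 h'
    exact notMem_colS h (mem_insert_self _ _)

lemma coeff_colP (N k c : ℕ) :
    (colP N k).coeff c = if k = 0 then (if c = 0 then 1 else 0) else
      if c = 0 then 0 else ((N.choose c * (c - 1).choose (k - 1) : ℕ) : ℚ) := by
  induction N generalizing k c with
  | zero =>
    cases k with
    | zero => simp [colP, colS, Polynomial.coeff_one]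
    | succ k => cases c <;> simp [colP, colS]
  | succ N ih =>
    cases k with
    | zero => simp [colP, colS, Polynomial.coeff_one]
    | succ k =>
      rw [colP_succ]
      cases c with
      | zero => simp [ih]
      | succ c =>
        rw [Polynomial.coeff_add, Polynomial.coeff_X_mul, Polynomial.coeff_add, ih, ih, ih]
        cases c with
        | zero => cases k <;> simp
        | succ c =>
          cases k with
          | zero => simp [Nat.choose_succ_succ (n := N)]; ring
          | succ k =>
            simp [Nat.choose_succ_succ (n := N), Nat.choose_succ_succ (n := c)]; ring

lemma SVT_eq_colS (n k : ℕ) (hkn : k ≤ n) :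
    SVT n (fun i => if i < k then 1 else 0) = colS n k := by
  have hy : ∀ i j, (i, j) ∈ youngCells n (fun i => if i < k then 1 else 0) ↔ i < k ∧ j = 0 := by
    intro i j
    simp only [youngCells, mem_biUnion, mem_range, mem_product, mem_singleton]
    constructor
    · rintro ⟨a, ha, rfl, h⟩
      split_ifs at h <;> omega
    · rintro ⟨h, rfl⟩
      exact ⟨i, by omega, rfl, by simp [h]⟩
  ext T
  rw [mem_colS]
  simp only [SVT, mem_filter, mem_powerset, ColValid]
  constructor
  · rintro ⟨hs, h1, -, h3⟩
    have hb : ∀ i j e, ((i, j), e) ∈ T → i < k ∧ j = 0 ∧ 1 ≤ e ∧ e ≤ n := by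
      intro i j e h
      have := hs h
      rw [mem_product, hy, mem_Icc] at this
      simpa [and_assoc] using this
    have hn : ∀ i, i < k → ∃ e, ((i, 0), e) ∈ T := by
      intro i hi
      obtain ⟨⟨p, e⟩, hx, rfl⟩ := h1 (i, 0) ((hy _ _).2 ⟨hi, rfl⟩)
      exact ⟨e, hx⟩
    refine ⟨hb, hn, ?_⟩
    have : ∀ d i e e', ((i, 0), e) ∈ T → ((i + d + 1, 0), e') ∈ T → e < e' := by
      intro d
      induction d with
      | zero => intro i e e' h h'; exact h3 _ h _ h' rfl rfl
      | succ d ih =>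
        intro i e e' h h'
        have := (hb _ _ _ h').1
        obtain ⟨f, hf⟩ := hn (i + d + 1) (by omega)
        exact (ih i e f h hf).trans (h3 _ hf _ h' rfl rfl)
    intro i e i' e' h h' hlt
    obtain ⟨d, rfl⟩ := Nat.exists_eq_add_of_lt hlt
    exact this d i e e' h h'
  · rintro ⟨hb, hn, h3⟩
    refine ⟨?_, ?_, ?_, ?_⟩
    · rintro ⟨⟨i, j⟩, e⟩ h
      rw [mem_product, hy, mem_Icc]
      simpa [and_assoc] using hb _ _ _ h
    · rintro ⟨i, j⟩ h
      obtain ⟨hi, rfl⟩ := (hy _ _).1 h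
      obtain ⟨e, he⟩ := hn i hi
      exact ⟨_, he, rfl⟩
    · rintro ⟨⟨i, j⟩, e⟩ h ⟨⟨i', j'⟩, e'⟩ h' _ h2
      have := hb _ _ _ h
      have := hb _ _ _ h'
      simp only at h2
      omega
    · rintro ⟨⟨i, j⟩, e⟩ h ⟨⟨i', j'⟩, e'⟩ h' h1 h2
      obtain ⟨_, rfl, _⟩ := hb _ _ _ h
      obtain ⟨_, rfl, _⟩ := hb _ _ _ h'
      exact h3 _ _ _ _ h h' (by simp only at h1; omega)

lemma le_card_colS {N k : ℕ} {T : Finset ((ℕ × ℕ) × ℕ)} (h : T ∈ colS N k) : k ≤ T.card := by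
  rw [mem_colS] at h
  have : range k ⊆ T.image (fun x => x.1.1) := by
    intro i hi
    obtain ⟨e, he⟩ := h.2.1 i (mem_range.1 hi)
    exact mem_image.2 ⟨_, he, rfl⟩
  have := (card_le_card this).trans card_image_le
  simpa using this

lemma binom_aux (n k m : ℕ) (hk : 1 ≤ k) (hkn : k ≤ n) :
    ((n.choose (k + m) * (k + m - 1).choose (k - 1) : ℕ) : ℚ) =
      (n.choose k : ℚ) * ((k : ℚ) / ((k : ℚ) + (m : ℚ)) * (((n - k).choose m : ℚ))) := by
  obtain ⟨k, rfl⟩ : ∃ l, k = l + 1 := ⟨k - 1, by omega⟩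
  have e1 : k + 1 + m - 1 = k + m := by omega
  have h1 : n.choose (k + 1 + m) * (k + 1 + m).choose (k + 1)
      = n.choose (k + 1) * (n - (k + 1)).choose m := by
    by_cases h : k + 1 + m ≤ n
    · have := Nat.choose_mul (n := n) (k := k + 1 + m) (s := k + 1) (by omega)
      rw [this]; congr 2; omega
    · rw [Nat.choose_eq_zero_of_lt (by omega : n < k + 1 + m),
        Nat.choose_eq_zero_of_lt (by omega : n - (k + 1) < m)]; simp
  have h2 : (k + m + 1) * (k + m).choose k = (k + 1 + m).choose (k + 1) * (k + 1) := by
    have := Nat.add_one_mul_choose_eq (k + m) k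
    rw [this]; congr 2; omega
  rw [e1, Nat.add_sub_cancel]
  have h1' := congrArg (Nat.cast : ℕ → ℚ) h1
  have h2' := congrArg (Nat.cast : ℕ → ℚ) h2
  push_cast at h1' h2' ⊢
  have : (k : ℚ) + 1 + m ≠ 0 := by positivity
  field_simp
  linear_combination (n.choose (k + 1 + m) : ℚ) * h2' + ((k : ℚ) + 1) * h1'

/-- For `n ≥ 1` and `1 ≤ k ≤ n`, the principal specialization of the
stable Grothendieck polynomial of the single-column partition `(1^k)` satisfies, as an
identity of polynomials in `β` over `ℚ`:
`Σ_{T ∈ SVT((1^k),n)} β^(|T|-k) = C(n,k) · Σ_{m=0}^{n-k} (k/(k+m)) C(n-k,m) β^m`. -/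
theorem grothendieck_single_column (n k : ℕ) (hk : 1 ≤ k) (hkn : k ≤ n) :
    ∑ T ∈ SVT n (fun i => if i < k then 1 else 0), (Polynomial.X : Polynomial ℚ) ^ (T.card - k)
      = Polynomial.C ((n.choose k : ℚ)) *
        ∑ m ∈ Finset.range (n - k + 1),
          Polynomial.C ((k : ℚ) / ((k : ℚ) + (m : ℚ)) * (((n - k).choose m : ℚ))) *
            Polynomial.X ^ m := by
  rw [SVT_eq_colS n k hkn]
  apply mul_left_cancel₀ (pow_ne_zero k (Polynomial.X_ne_zero (R := ℚ)))
  have hL : Polynomial.X ^ k * ∑ T ∈ colS n k, (Polynomial.X : Polynomial ℚ) ^ (T.card - k)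
      = colP n k := by
    rw [mul_sum, colP]
    apply sum_congr rfl
    intro T hT
    rw [← pow_add, Nat.add_sub_cancel' (le_card_colS hT)]
  rw [hL]
  ext c
  rw [coeff_colP, Polynomial.coeff_X_pow_mul', if_neg (by omega)]
  by_cases hc : k ≤ c
  · obtain ⟨m, rfl⟩ := Nat.exists_eq_add_of_le hc
    rw [if_neg (by omega), if_pos hc, binom_aux n k m hk hkn, Nat.add_sub_cancel_left,
      Polynomial.coeff_C_mul, Polynomial.finset_sum_coeff]
    simp only [Polynomial.coeff_C_mul_X_pow]
    rw [Finset.sum_ite_eq]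
    split_ifs with h
    · rfl
    · rw [mem_range] at h
      rw [Nat.choose_eq_zero_of_lt (by omega : n - k < m)]
      simp
  · rw [if_neg hc]
    split_ifs with h0
    · rfl
    · rw [Nat.choose_eq_zero_of_lt (by omega : c - 1 < k - 1)]
      simp
end

section
/- Let n ≥ 1, let λ_1 ≥ λ_2 ≥ … ≥ λ_n ≥ 0 be integers, and let q, β_1, …, β_{n−1} be elements of a commutative ring. Then the n×n determinant whose (i,j) entry is q^{(i−1)(λ_j + n − j)} · ∏_{l=1}^{j−1} (1 + β_l q^{i−1}) satisfies: det( q^{(i−1)(λ_j+n−j)} ∏_{l=1}^{j−1}(1+β_l q^{i−1}) ) = Σ_{k_1=0}^{0} Σ_{k_2=0}^{1} ⋯ Σ_{k_n=0}^{n−1} e_{k_1}^{(0)} e_{k_2}^{(1)} ⋯ e_{k_n}^{(n−1)} · ∏_{1≤i<j≤n} ( q^{λ_j + n − j + k_j} − q^{λ_i + n − i + k_i} ), where e_k^{(j−1)} = e_k(β_1,…,β_{j−1}) is the k-th elementary symmetric polynomial in β_1,…,β_{j−1} (with e_0 = 1). Equivalently, the refined Grothendieck polynomial G_λ(1, q,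 q², …, q^{n−1} | β⃗) defined as this determinant divided by the Vandermonde determinant ∏_{1≤i<j≤n}(q^{n−j} − q^{n−i}) equals Σ_{k} ∏_j e_{k_j}^{(j−1)} ∏_{1≤i<j≤n} (q^{λ_j+n−j+k_j} − q^{λ_i+n−i+k_i})/(q^{n−j} − q^{n−i}). -/
open Finset

/-- The `k`-th elementary symmetric polynomial `e_k(b 0, …, b (m-1))` of the first `m`
variables: the sum over all `k`-element subsets of the products of the chosen variables
(with `e_0 = 1`). -/
def esymm {R : Type*} [CommRing R] (b : ℕ → R) (m k : ℕ) : R :=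
  ∑ s ∈ (Finset.range m).powersetCard k, ∏ l ∈ s, b l

/-- Generating function of the elementary symmetric polynomials. -/
theorem prod_one_add_eq_sum_esymm {R : Type*} [CommRing R] (b : ℕ → R) (m : ℕ) (x : R) :
    ∏ l ∈ Finset.range m, (1 + b l * x) = ∑ k ∈ Finset.range (m + 1), esymm b m k * x ^ k := by
  rw [Finset.prod_one_add, Finset.sum_powerset, Finset.card_range]
  refine Finset.sum_congr rfl fun k _ => ?_
  rw [esymm, Finset.sum_mul]
  refine Finset.sum_congr rfl fun s hs => ?_
  rw [Finset.prod_mul_distrib, Finset.prod_const, (Finset.mem_powersetCard.mp hs).2]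

/-- For `n ≥ 1`, integers `λ_1 ≥ … ≥ λ_n ≥ 0` and elements
`q, β_1, …, β_{n-1}` of a commutative ring, the principal specialization `x_i = q^{i-1}`
of the refined bi-alternant numerator satisfies (indices `0`-indexed, so the `(i,j)`
entry `q^{(i-1)(λ_j+n-j)} ∏_{l=1}^{j-1}(1+β_l q^{i-1})` becomes
`q ^ (i * (lam j + (n-1-j))) * ∏_{l<j} (1 + b l * q ^ i)`):
`det = Σ_{k_1=0}^{0} … Σ_{k_n=0}^{n-1} e_{k_1}^{(0)} ⋯ e_{k_n}^{(n-1)} ·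
∏_{1≤i<j≤n} (q^{λ_j+n-j+k_j} − q^{λ_i+n-i+k_i})`,
where `e_k^{(j-1)} = e_k(β_1, …, β_{j-1})`. -/
theorem det_refined_grothendieck_principal_specialization
    {R : Type*} [CommRing R] (n : ℕ) (hn : 1 ≤ n) (q : R) (b : ℕ → R)
    (lam : Fin n → ℕ) (hlam : ∀ i j : Fin n, i ≤ j → lam j ≤ lam i) :
    Matrix.det (Matrix.of fun i j : Fin n =>
        q ^ (i.val * (lam j + (n - 1 - j.val))) *
          ∏ l ∈ Finset.range j.val, (1 + b l * q ^ i.val))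
      = ∑ k ∈ Fintype.piFinset (fun j : Fin n => Finset.range (j.val + 1)),
          (∏ j : Fin n, esymm b j.val (k j)) *
            ∏ p ∈ Finset.univ.filter (fun p : Fin n × Fin n => p.1 < p.2),
              (q ^ (lam p.2 + (n - 1 - p.2.val) + k p.2)
                - q ^ (lam p.1 + (n - 1 - p.1.val) + k p.1)) := by
  have hrow : (Matrix.of fun i j : Fin n =>
        q ^ (i.val * (lam j + (n - 1 - j.val))) *
          ∏ l ∈ Finset.range j.val, (1 + b l * q ^ i.val)).transpose
      = fun j : Fin n => ∑ k ∈ Finset.range (j.val + 1),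
          esymm b j.val k • fun i : Fin n => (q ^ (lam j + (n - 1 - j.val) + k)) ^ i.val := by
    funext j i
    rw [Matrix.transpose_apply, Matrix.of_apply, prod_one_add_eq_sum_esymm, Finset.mul_sum,
      Finset.sum_apply]
    refine Finset.sum_congr rfl fun k _ => ?_
    rw [Pi.smul_apply, smul_eq_mul]
    ring
  rw [← Matrix.det_transpose, hrow]
  have h := (Matrix.detRowAlternating (R := R) (n := Fin n)).toMultilinearMap.map_sum_finset
    (fun (j : Fin n) (k : ℕ) =>
      esymm b j.val k • fun i : Fin n => (q ^ (lam j + (n - 1 - j.val) + k)) ^ i.val)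
    (fun j : Fin n => Finset.range (j.val + 1))
  refine h.trans (Finset.sum_congr rfl fun k _ => ?_)
  rw [MultilinearMap.map_smul_univ, smul_eq_mul]
  congr 1
  refine (Matrix.det_vandermonde
    (fun j : Fin n => q ^ (lam j + (n - 1 - j.val) + k j))).trans ?_
  rw [Finset.prod_sigma']
  refine Finset.prod_bij' (fun p _ => (p.1, p.2)) (fun p _ => ⟨p.1, p.2⟩) ?_ ?_ ?_ ?_ ?_ <;> simp
end

section
/- Let n ≥ 1, let λ_1 ≥ λ_2 ≥ … ≥ λ_n ≥ 0 be integers, and let q and β be elements of a commutative ring. Then the n×n determinant whose (i,j) entry is q^{(i−1)(λ_j + n − j)} · (1 + β q^{i−1})^{j−1} satisfies: det( q^{(i−1)(λ_j+n−j)} (1+β q^{i−1})^{j−1} ) = Σ_{k_1=0}^{0} Σ_{k_2=0}^{1} ⋯ Σ_{k_n=0}^{n−1} C(0, k_1) C(1, k_2) ⋯ C(n−1, k_n) · β^{k_1 + k_2 + ⋯ + k_n} · ∏_{1≤i<j≤n} ( q^{λ_j + n − j + k_j} − q^{λ_i + n − i + k_i} ). Equivalently, the Grothendieck polynomial G_λ(1,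 q, q², …, q^{n−1} | β), defined as this determinant divided by the Vandermonde determinant ∏_{1≤i<j≤n}(q^{n−j} − q^{n−i}), equals Σ_k ∏_j C(j−1, k_j) β^{Σ_j k_j} ∏_{1≤i<j≤n} (q^{λ_j+n−j+k_j} − q^{λ_i+n−i+k_i})/(q^{n−j} − q^{n−i}). -/
open Finset

/-- For `n ≥ 1`, integers `λ_1 ≥ … ≥ λ_n ≥ 0` and elements `q, β` of a
commutative ring, the principal specialization `x_i = q^{i-1}` of the bi-alternant
numerator of the stable Grothendieck polynomial satisfies (indices `0`-indexed, so the
`(i,j)` entry `q^{(i-1)(λ_j+n-j)} (1+β q^{i-1})^{j-1}` becomes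
`q ^ (i * (lam j + (n-1-j))) * (1 + β * q ^ i) ^ j`):
`det = Σ_{k_1=0}^{0} … Σ_{k_n=0}^{n-1} C(0,k_1) ⋯ C(n-1,k_n) β^{k_1+⋯+k_n} ·
∏_{1≤i<j≤n} (q^{λ_j+n-j+k_j} − q^{λ_i+n-i+k_i})`. -/
theorem det_grothendieck_principal_specialization
    {R : Type*} [CommRing R] (n : ℕ) (hn : 1 ≤ n) (q β : R)
    (lam : Fin n → ℕ) (hlam : ∀ i j : Fin n, i ≤ j → lam j ≤ lam i) :
    Matrix.det (Matrix.of fun i j : Fin n =>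
        q ^ (i.val * (lam j + (n - 1 - j.val))) * (1 + β * q ^ i.val) ^ j.val)
      = ∑ k ∈ Fintype.piFinset (fun j : Fin n => Finset.range (j.val + 1)),
          ((∏ j : Fin n, (j.val).choose (k j) : ℕ) : R) * β ^ (∑ j : Fin n, k j) *
            ∏ p ∈ Finset.univ.filter (fun p : Fin n × Fin n => p.1 < p.2),
              (q ^ (lam p.2 + (n - 1 - p.2.val) + k p.2)
                - q ^ (lam p.1 + (n - 1 - p.1.val) + k p.1)) := by
  set a : Fin n → ℕ := fun j => lam j + (n - 1 - j.val) with ha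
  have hrow : (Matrix.of fun i j : Fin n =>
        q ^ (i.val * (lam j + (n - 1 - j.val))) * (1 + β * q ^ i.val) ^ j.val).transpose
      = fun j : Fin n => ∑ k ∈ Finset.range (j.val + 1),
          (((j.val.choose k : ℕ) : R) * β ^ k) • (fun i : Fin n => (q ^ (a j + k)) ^ i.val) := by
    funext j i
    rw [Finset.sum_apply]
    simp only [Matrix.transpose_apply, Matrix.of_apply, Pi.smul_apply, smul_eq_mul]
    rw [add_comm (1 : R), add_pow, Finset.mul_sum]
    refine Finset.sum_congr rfl fun k _ => ?_
    simp only [ha, one_pow, mul_pow, ← pow_mul, add_mul, pow_add, mul_add, mul_comm i.val]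
    ring
  rw [← Matrix.det_transpose, hrow]
  have key := (Matrix.detRowAlternating (n := Fin n) (R := R)).toMultilinearMap.map_sum_finset
    (fun (j : Fin n) (k : ℕ) =>
      (((j.val.choose k : ℕ) : R) * β ^ k) • (fun i : Fin n => (q ^ (a j + k)) ^ i.val))
    (fun j : Fin n => Finset.range (j.val + 1))
  refine key.trans (Finset.sum_congr rfl fun k _ => ?_)
  rw [MultilinearMap.map_smul_univ, smul_eq_mul, Finset.prod_mul_distrib,
    Finset.prod_pow_eq_pow_sum, Nat.cast_prod]
  congr 1
  refine (Matrix.det_vandermonde (fun j => q ^ (a j + k j))).trans ?_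
  rw [Finset.prod_filter, ← Finset.univ_product_univ, Finset.prod_product]
  refine Finset.prod_congr rfl fun i _ => ?_
  rw [← Finset.prod_filter]
  refine Finset.prod_congr ?_ fun _ _ => rfl
  ext j
  simp
end

section
/- Let n ≥ 1 and let λ = (λ_1 ≥ λ_2 ≥ … ≥ λ_n ≥ 0) be a partition (padded with zeros to length n). Then the number of set-valued tableaux of shape λ with entries in {1,…,n} is given by the rational-number identity: |SVT(λ, n)| = Σ_{k_1=0}^{0} Σ_{k_2=0}^{1} ⋯ Σ_{k_n=0}^{n−1} C(0, k_1) C(1, k_2) ⋯ C(n−1, k_n) · ∏_{1≤i<j≤n} (λ_i − λ_j + k_i − k_j + j − i)/(j − i). -/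
open Finset

lemma mem_youngCells {n : ℕ} {lam : ℕ → ℕ} {p : ℕ × ℕ} :
    p ∈ youngCells n lam ↔ p.1 < n ∧ p.2 < lam p.1 := by
  obtain ⟨i, j⟩ := p
  simp [youngCells]

/-- The conditions for membership, unfolded. -/
lemma mem_SVT {n : ℕ} {lam : ℕ → ℕ} {T : Finset ((ℕ × ℕ) × ℕ)} :
    T ∈ SVT n lam ↔
      (∀ i j e, ((i, j), e) ∈ T → (i < n ∧ j < lam i) ∧ 1 ≤ e ∧ e ≤ n) ∧
      (∀ i j, i < n → j < lam i → ∃ e, ((i, j), e) ∈ T) ∧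
      (∀ i j e f, ((i, j), e) ∈ T → ((i, j + 1), f) ∈ T → e ≤ f) ∧
      (∀ i j e f, ((i, j), e) ∈ T → ((i + 1, j), f) ∈ T → e < f) := by
  simp only [SVT, mem_filter, mem_powerset]
  constructor
  · rintro ⟨h0, h1, h2, h3⟩
    refine ⟨?_, ?_, ?_, ?_⟩
    · intro i j e h
      have := h0 h
      simpa [mem_youngCells] using this
    · intro i j hi hj
      obtain ⟨⟨p, e⟩, hx, rfl⟩ := h1 (i, j) (mem_youngCells.2 ⟨hi, hj⟩)
      exact ⟨e, hx⟩
    · intro i j e f he hf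
      exact h2 _ he _ hf rfl rfl
    · intro i j e f he hf
      exact h3 _ he _ hf rfl rfl
  · rintro ⟨h0, h1, h2, h3⟩
    refine ⟨?_, ?_, ?_, ?_⟩
    · rintro ⟨⟨i, j⟩, e⟩ h
      simpa [mem_youngCells] using h0 i j e h
    · rintro ⟨i, j⟩ hp
      obtain ⟨e, he⟩ := h1 i j (mem_youngCells.1 hp).1 (mem_youngCells.1 hp).2
      exact ⟨_, he, rfl⟩
    · rintro ⟨⟨i, j⟩, e⟩ he ⟨⟨i', j'⟩, f⟩ hf h h'
      simp only at h h'
      subst h h'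
      exact h2 _ _ _ _ he hf
    · rintro ⟨⟨i, j⟩, e⟩ he ⟨⟨i', j'⟩, f⟩ hf h h'
      simp only at h h'
      subst h h'
      exact h3 _ _ _ _ he hf

/-- Extension of a finite sequence by zero. -/
def extZ {n : ℕ} (mu : Fin n → ℕ) : ℕ → ℕ := fun i => if h : i < n then mu ⟨i, h⟩ else 0

/-- Glue a tableau of the smaller shape with the boxes containing the entry `n + 1`. -/
def glueSVT (n : ℕ) (lam : ℕ → ℕ) (mu : Fin n → ℕ) (T : Finset ((ℕ × ℕ) × ℕ))
    (S : Finset (Fin n)) : Finset ((ℕ × ℕ) × ℕ) :=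
  T ∪ ((youngCells (n + 1) lam).filter (fun p => extZ mu p.1 ≤ p.2 ∨
    ∃ h : p.1 < n, p.2 + 1 = extZ mu p.1 ∧ (⟨p.1, h⟩ : Fin n) ∈ S)) ×ˢ {n + 1}

lemma mem_glueSVT {n : ℕ} {lam : ℕ → ℕ} {mu : Fin n → ℕ} {T : Finset ((ℕ × ℕ) × ℕ)}
    {S : Finset (Fin n)} {i j e : ℕ} :
    ((i, j), e) ∈ glueSVT n lam mu T S ↔ ((i, j), e) ∈ T ∨
      (e = n + 1 ∧ i < n + 1 ∧ j < lam i ∧ (extZ mu i ≤ j ∨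
        ∃ h : i < n, j + 1 = extZ mu i ∧ (⟨i, h⟩ : Fin n) ∈ S)) := by
  simp only [glueSVT, mem_union, mem_product, mem_filter, mem_youngCells, mem_singleton]
  tauto

lemma glueSVT_mem {n : ℕ} {lam : ℕ → ℕ} {mu : Fin n → ℕ} {T : Finset ((ℕ × ℕ) × ℕ)} {S : Finset (Fin n)}
    (hmu : ∀ i : Fin n, lam (i + 1) ≤ mu i ∧ mu i ≤ lam i)
    (hT : T ∈ SVT n (extZ mu)) (hS : ∀ i ∈ S, lam (i + 1) < mu i) :
    glueSVT n lam mu T S ∈ SVT (n + 1) lam := by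
  obtain ⟨h0, h1, h2, h3⟩ := mem_SVT.1 hT
  have hm : ∀ i, i < n → lam (i + 1) ≤ extZ mu i ∧ extZ mu i ≤ lam i := by
    intro i hi
    simpa [extZ, hi] using hmu ⟨i, hi⟩
  have hS' : ∀ i (h : i < n), (⟨i, h⟩ : Fin n) ∈ S → lam (i + 1) < extZ mu i := by
    intro i hi h
    simpa [extZ, hi] using hS _ h
  rw [mem_SVT]
  refine ⟨?_, ?_, ?_, ?_⟩
  · intro i j e h
    rcases mem_glueSVT.1 h with h | ⟨rfl, hi, hj, -⟩
    · have := h0 _ _ _ h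
      have := hm i this.1.1
      omega
    · omega
  · intro i j hi hj
    by_cases h : extZ mu i ≤ j
    · exact ⟨n + 1, mem_glueSVT.2 (Or.inr ⟨rfl, hi, hj, Or.inl h⟩)⟩
    · have hin : i < n := by
        by_contra hin
        simp [extZ, hin] at h
      obtain ⟨e, he⟩ := h1 i j hin (by omega)
      exact ⟨e, mem_glueSVT.2 (Or.inl he)⟩
  · intro i j e f he hf
    rcases mem_glueSVT.1 he with he | ⟨rfl, hi, hj, hh⟩ <;>
    rcases mem_glueSVT.1 hf with hf | ⟨rfl, hi', hj', hh'⟩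
    · exact h2 _ _ _ _ he hf
    · have := h0 _ _ _ he; omega
    · have := h0 _ _ _ hf
      rcases hh with hh | ⟨_, hh, _⟩ <;> omega
    · exact le_rfl
  · intro i j e f he hf
    rcases mem_glueSVT.1 he with he | ⟨rfl, hi, hj, hh⟩
    · rcases mem_glueSVT.1 hf with hf | ⟨rfl, hi', hj', hh'⟩
      · exact h3 _ _ _ _ he hf
      · have := h0 _ _ _ he; omega
    · exfalso
      have hb : i + 1 < n + 1 ∧ j < lam (i + 1) := by
        rcases mem_glueSVT.1 hf with hf | ⟨rfl, hi', hj', hh'⟩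
        · have := h0 _ _ _ hf
          have := hm _ this.1.1
          omega
        · exact ⟨hi', hj'⟩
      have := hm i (by omega)
      rcases hh with hh | ⟨h, hh, h'⟩
      · omega
      · have := hS' i h h'
        omega

lemma glueSVT_small {n : ℕ} {lam : ℕ → ℕ} {mu : Fin n → ℕ} {T : Finset ((ℕ × ℕ) × ℕ)}
    {S : Finset (Fin n)} (hT : T ∈ SVT n (extZ mu)) {i j e : ℕ} :
    ((i, j), e) ∈ T ↔ ((i, j), e) ∈ glueSVT n lam mu T S ∧ e ≤ n := by
  rw [mem_glueSVT]
  constructor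
  · intro h
    have := (mem_SVT.1 hT).1 _ _ _ h
    exact ⟨Or.inl h, by omega⟩
  · rintro ⟨h | h, h'⟩
    · exact h
    · omega

lemma SVT_mu_iff {n : ℕ} {mu : Fin n → ℕ} {T : Finset ((ℕ × ℕ) × ℕ)}
    (hT : T ∈ SVT n (extZ mu)) (i : Fin n) (j : ℕ) :
    j < mu i ↔ ∃ e, ((i.val, j), e) ∈ T := by
  obtain ⟨h0, h1, h2, h3⟩ := mem_SVT.1 hT
  have e : extZ mu i = mu i := by simp [extZ]
  constructor
  · intro h
    exact h1 _ _ i.2 (by rw [e]; exact h)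
  · rintro ⟨f, hf⟩
    have := (h0 _ _ _ hf).1.2
    rwa [e] at this

lemma glueSVT_inj {n : ℕ} {lam : ℕ → ℕ}
    {mu mu' : Fin n → ℕ} {T T' : Finset ((ℕ × ℕ) × ℕ)} {S S' : Finset (Fin n)}
    (hmu : ∀ i : Fin n, lam (i + 1) ≤ mu i ∧ mu i ≤ lam i)
    (hT : T ∈ SVT n (extZ mu)) (hS : ∀ i ∈ S, lam (i + 1) < mu i)
    (hT' : T' ∈ SVT n (extZ mu')) (hS' : ∀ i ∈ S', lam (i + 1) < mu' i)
    (h : glueSVT n lam mu T S = glueSVT n lam mu' T' S') :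
    mu = mu' ∧ T = T' ∧ S = S' := by
  have hTT : T = T' := by
    ext ⟨⟨i, j⟩, e⟩
    rw [glueSVT_small (lam := lam) (S := S) hT, glueSVT_small (lam := lam) (S := S') hT', h]
  subst hTT
  have hmm : mu = mu' := by
    ext i
    have h1 := fun j => (SVT_mu_iff hT i j).trans (SVT_mu_iff hT' i j).symm
    have a := h1 (mu i)
    have b := h1 (mu' i)
    omega
  subst hmm
  refine ⟨rfl, rfl, ?_⟩
  have key : ∀ S : Finset (Fin n), (∀ i ∈ S, lam (i + 1) < mu i) → ∀ i,
      (i ∈ S ↔ lam (i + 1) < mu i ∧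
        ((i.val, mu i - 1), n + 1) ∈ glueSVT n lam mu T S) := by
    intro S hS i
    have e : extZ mu i = mu i := by simp [extZ]
    rw [mem_glueSVT, e]
    have h0 := (mem_SVT.1 hT).1 i (mu i - 1) (n + 1)
    have := hmu i
    constructor
    · intro hi
      have := hS i hi
      exact ⟨this, Or.inr ⟨rfl, by omega, by omega, Or.inr ⟨i.2, by omega, hi⟩⟩⟩
    · rintro ⟨ha, hb | ⟨-, -, -, hb | ⟨_, _, hb⟩⟩⟩
      · have := h0 hb; omega
      · omega
      · exact hb
  ext i
  rw [key S hS, key S' hS', h]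

lemma SVT_row_le {n : ℕ} {lam : ℕ → ℕ} (hdec : ∀ i j : ℕ, i ≤ j → lam j ≤ lam i)
    {T : Finset ((ℕ × ℕ) × ℕ)} (hT : T ∈ SVT n lam) :
    ∀ i j e, ((i, j), e) ∈ T → i + 1 ≤ e := by
  obtain ⟨h0, h1, h2, h3⟩ := mem_SVT.1 hT
  intro i
  induction i with
  | zero => intro j e h; have := h0 _ _ _ h; omega
  | succ i ih =>
    intro j e h
    have a := h0 _ _ _ h
    have b := hdec i (i + 1) (by omega)
    obtain ⟨f, hf⟩ := h1 i j (by omega) (by omega)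
    have := ih j f hf
    have := h3 _ _ _ _ hf h
    omega

lemma glueSVT_surj {n : ℕ} {lam : ℕ → ℕ} (hdec : ∀ i j : ℕ, i ≤ j → lam j ≤ lam i)
    {T : Finset ((ℕ × ℕ) × ℕ)} (hT : T ∈ SVT (n + 1) lam) :
    ∃ (mu : Fin n → ℕ) (T' : Finset ((ℕ × ℕ) × ℕ)) (S : Finset (Fin n)),
      (∀ i : Fin n, lam (i + 1) ≤ mu i ∧ mu i ≤ lam i) ∧ T' ∈ SVT n (extZ mu) ∧
      (∀ i ∈ S, lam (i + 1) < mu i) ∧ glueSVT n lam mu T' S = T := by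
  classical
  obtain ⟨h0, h1, h2, h3⟩ := mem_SVT.1 hT
  have hrow := SVT_row_le hdec hT
  have hex : ∀ i : Fin n, ∃ m, m ≤ lam i ∧ ∀ j, j < m ↔ ∃ e, ((i.val, j), e) ∈ T ∧ e ≤ n := by
    intro i
    have hP : ∃ m, ¬ ∃ e, ((i.val, m), e) ∈ T ∧ e ≤ n := by
      refine ⟨lam i, ?_⟩
      rintro ⟨e, he, -⟩
      have := h0 _ _ _ he
      omega
    refine ⟨Nat.find hP, ?_, ?_⟩
    · apply Nat.find_min' hP
      rintro ⟨e, he, -⟩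
      have := h0 _ _ _ he
      omega
    · intro j
      constructor
      · intro hj
        have := Nat.find_min hP hj
        rwa [not_not] at this
      · intro hj
        by_contra hlt
        replace hlt := not_lt.1 hlt
        have hall : ∀ d, ¬ ∃ e, ((i.val, Nat.find hP + d), e) ∈ T ∧ e ≤ n := by
          intro d
          induction d with
          | zero => exact Nat.find_spec hP
          | succ d ih =>
            rintro ⟨e, he, hen⟩
            have a := h0 _ _ _ he
            obtain ⟨f, hf⟩ := h1 i (Nat.find hP + d) (by omega) (by omega)
            exact ih ⟨f, hf, (h2 _ _ _ _ hf he).trans hen⟩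
        apply hall (j - Nat.find hP)
        rwa [Nat.add_sub_cancel' hlt]
  choose mu hmu1 hmu2 using hex
  have hE : ∀ (i : ℕ) (h : i < n), extZ mu i = mu ⟨i, h⟩ := by
    intro i h; simp [extZ, h]
  have hiff : ∀ i j, j < extZ mu i ↔ ∃ e, ((i, j), e) ∈ T ∧ e ≤ n := by
    intro i j
    by_cases h : i < n
    · rw [hE i h]; exact hmu2 ⟨i, h⟩ j
    · simp only [extZ, h, dite_false, not_lt_zero, false_iff]
      rintro ⟨e, he, hen⟩
      have := hrow _ _ _ he
      omega
  have hbig : ∀ i j, ((i, j), n + 1) ∈ T → i < n → lam (i + 1) ≤ j := by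
    intro i j h hi
    by_contra hj
    obtain ⟨f, hf⟩ := h1 (i + 1) j (by omega) (by omega)
    have := h3 _ _ _ _ h hf
    have := h0 _ _ _ hf
    omega
  refine ⟨mu, T.filter (fun x => x.2 ≤ n),
    univ.filter (fun i : Fin n => 0 < mu i ∧ ((i.val, mu i - 1), n + 1) ∈ T), ?_, ?_, ?_, ?_⟩
  · intro i
    refine ⟨?_, hmu1 i⟩
    by_contra hlt
    have := hdec i (i + 1) (by omega)
    obtain ⟨e, he⟩ := h1 i (mu i) (by omega) (by omega)
    have a := h0 _ _ _ he
    have b : ¬ e ≤ n := fun hen => lt_irrefl _ ((hmu2 i (mu i)).2 ⟨e, he, hen⟩)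
    obtain rfl : e = n + 1 := by omega
    have := hbig _ _ he i.2
    omega
  · rw [mem_SVT]
    refine ⟨?_, ?_, ?_, ?_⟩
    · intro i j e h
      obtain ⟨h, hen⟩ := mem_filter.1 h
      have a := h0 _ _ _ h
      have b := hrow _ _ _ h
      refine ⟨⟨?_, (hiff i j).2 ⟨e, h, hen⟩⟩, a.2.1, hen⟩
      simp only at hen
      omega
    · intro i j _ hj
      obtain ⟨e, he, hen⟩ := (hiff i j).1 hj
      exact ⟨e, mem_filter.2 ⟨he, hen⟩⟩
    · intro i j e f he hf
      exact h2 _ _ _ _ (mem_filter.1 he).1 (mem_filter.1 hf).1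
    · intro i j e f he hf
      exact h3 _ _ _ _ (mem_filter.1 he).1 (mem_filter.1 hf).1
  · intro i hi
    obtain ⟨-, hp, hi⟩ := mem_filter.1 hi
    have := hbig _ _ hi i.2
    omega
  · ext ⟨⟨i, j⟩, e⟩
    rw [mem_glueSVT]
    simp only [mem_filter, mem_univ, true_and]
    constructor
    · rintro (h | ⟨rfl, hi, hj, h | ⟨hin, hj', hp, h⟩⟩)
      · exact h.1
      · obtain ⟨e, he⟩ := h1 i j hi hj
        have a := h0 _ _ _ he
        have b : ¬ e ≤ n := fun hen => by
          have := (hiff i j).2 ⟨e, he, hen⟩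
          omega
        obtain rfl : e = n + 1 := by omega
        exact he
      · rw [hE i hin] at hj'
        rw [← hj'] at h
        exact h
    · intro h
      have a := h0 _ _ _ h
      by_cases hen : e ≤ n
      · exact Or.inl ⟨h, hen⟩
      · obtain rfl : e = n + 1 := by omega
        refine Or.inr ⟨rfl, a.1.1, a.1.2, ?_⟩
        by_cases hj : extZ mu i ≤ j
        · exact Or.inl hj
        · right
          push Not at hj
          have hin : i < n := by
            by_contra hin
            simp [extZ, hin] at hj
          have hj1 : j + 1 = extZ mu i := by
            by_contra hne
            obtain ⟨f, hf, hfn⟩ := (hiff i (j + 1)).1 (by omega)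
            have := h2 _ _ _ _ h hf
            omega
          refine ⟨hin, hj1, ?_⟩
          rw [hE i hin] at hj1
          rw [← hj1]
          exact ⟨by omega, h⟩

lemma card_SVT_succ (n : ℕ) (lam : ℕ → ℕ) (hdec : ∀ i j : ℕ, i ≤ j → lam j ≤ lam i) :
    (SVT (n + 1) lam).card
      = ∑ mu ∈ Fintype.piFinset (fun i : Fin n => Icc (lam (i + 1)) (lam i)),
        (∏ i : Fin n, (if lam (i + 1) < mu i then 2 else 1)) * (SVT n (extZ mu)).card := by
  classical
  have hc : ∀ mu : Fin n → ℕ, (∏ i : Fin n, (if lam (i + 1) < mu i then 2 else 1))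
      * (SVT n (extZ mu)).card = (SVT n (extZ mu) ×ˢ
        (univ.filter (fun i : Fin n => lam (i + 1) < mu i)).powerset).card := by
    intro mu
    rw [card_product, card_powerset, mul_comm, Finset.prod_ite]
    simp
  simp only [hc]
  rw [← Finset.card_sigma]
  symm
  apply Finset.card_bij (fun x _ => glueSVT n lam x.1 x.2.1 x.2.2)
  · rintro ⟨mu, T, S⟩ h
    simp only [mem_sigma, Fintype.mem_piFinset, mem_Icc, mem_product, mem_powerset] at h
    exact glueSVT_mem h.1 h.2.1 (fun i hi => (mem_filter.1 (h.2.2 hi)).2)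
  · rintro ⟨mu, T, S⟩ h ⟨mu', T', S'⟩ h' he
    simp only [mem_sigma, Fintype.mem_piFinset, mem_Icc, mem_product, mem_powerset] at h h'
    obtain ⟨rfl, rfl, rfl⟩ := glueSVT_inj h.1 h.2.1 (fun i hi => (mem_filter.1 (h.2.2 hi)).2)
      h'.2.1 (fun i hi => (mem_filter.1 (h'.2.2 hi)).2) he
    rfl
  · intro T hT
    obtain ⟨mu, T', S, a, b, c, d⟩ := glueSVT_surj hdec hT
    refine ⟨⟨mu, T', S⟩, ?_, d⟩
    simp only [mem_sigma, Fintype.mem_piFinset, mem_Icc, mem_product, mem_powerset]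
    exact ⟨a, b, fun i hi => mem_filter.2 ⟨mem_univ _, c i hi⟩⟩

def hSVT : ℕ → ℕ → ℕ → ℚ
  | 0, a, r => (a.choose r : ℚ)
  | j + 1, a, r => hSVT j a r + hSVT j (a + 1) r

lemma hSVT_zero_right (j a : ℕ) : hSVT j a 0 = 2 ^ j := by
  induction j generalizing a with
  | zero => simp [hSVT]
  | succ j ih => rw [hSVT, ih, ih, pow_succ]; ring

lemma hSVT_pascal (j a r : ℕ) : hSVT j (a + 1) (r + 1) = hSVT j a (r + 1) + hSVT j a r := by
  induction j generalizing a with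
  | zero => simp only [hSVT]; rw [Nat.choose_succ_succ]; push_cast; ring
  | succ j ih => simp only [hSVT]; rw [ih (a + 1), ih a]; ring

lemma hSVT_eq_sum (j a r : ℕ) :
    hSVT j a r = ∑ k ∈ range (j + 1), (j.choose k : ℚ) * ((a + k).choose r : ℚ) := by
  induction j generalizing a with
  | zero => simp [hSVT]
  | succ j ih =>
    have h := Finset.sum_choose_succ_mul (R := ℚ) (fun k _ => ((a + k).choose r : ℚ)) j
    rw [h, hSVT, ih, ih]
    congr 1
    apply sum_congr rfl
    intro k _
    rw [show a + 1 + k = a + (k + 1) by ring]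

lemma hSVT_row_sum (j s r b c : ℕ) (hbc : b ≤ c) :
    ∑ m ∈ Icc b c, (if b < m then (2 : ℚ) else 1) * hSVT j (m + s) r
      = 2 * hSVT j (c + 1 + s) (r + 1) - hSVT (j + 1) (b + s) (r + 1) := by
  induction c, hbc using Nat.le_induction with
  | base =>
    simp only [Icc_self, sum_singleton, lt_irrefl, if_false, hSVT]
    have := hSVT_pascal j (b + s) r
    rw [show b + 1 + s = b + s + 1 by ring]
    linarith
  | succ c hbc ih =>
    rw [← Finset.insert_Icc_right_eq_Icc_add_one (by omega), sum_insert (by simp), ih]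
    have := hSVT_pascal j (c + 1 + s) r
    rw [if_pos (by omega), show c + 1 + 1 + s = c + 1 + s + 1 by ring]
    linarith

def MSVT (n : ℕ) (lam : ℕ → ℕ) : Matrix (Fin n) (Fin n) ℚ :=
  Matrix.of fun j r => (-1) ^ (r : ℕ) * hSVT j (lam j + (n - 1 - j)) r

lemma det_sum_rows {n : ℕ} (A : Fin n → Finset ℕ) (w : Fin n → ℕ → ℚ)
    (g : Fin n → ℕ → Fin n → ℚ) :
    (Matrix.of fun i r => ∑ m ∈ A i, w i m * g i m r).det
      = ∑ k ∈ Fintype.piFinset A, (∏ i, w i (k i)) * (Matrix.of fun i r => g i (k i) r).det := by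
  have h := (Matrix.detRowAlternating (n := Fin n) (R := ℚ)).toMultilinearMap.map_sum_finset
    (fun i m => (fun r => w i m * g i m r : Fin n → ℚ)) A
  have e : (Matrix.of fun i r => ∑ m ∈ A i, w i m * g i m r)
      = (fun i => ∑ m ∈ A i, (fun r => w i m * g i m r : Fin n → ℚ)) := by
    ext i r; simp [Finset.sum_apply]
  rw [e]
  refine Eq.trans h ?_
  apply sum_congr rfl
  intro k _
  exact Matrix.det_mul_column (fun i => w i (k i)) (Matrix.of fun i r => g i (k i) r)

lemma det_MSVT_succ (n : ℕ) (lam : ℕ → ℕ) (hdec : ∀ i j : ℕ, i ≤ j → lam j ≤ lam i) :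
    (MSVT (n + 1) lam).det
      = ∑ mu ∈ Fintype.piFinset (fun i : Fin n => Icc (lam (i + 1)) (lam i)),
        (∏ i : Fin n, (if lam (i + 1) < mu i then (2 : ℚ) else 1)) *
          (MSVT n (fun i => if h : i < n then mu ⟨i, h⟩ else 0)).det := by
  let B : Matrix (Fin (n + 1)) (Fin (n + 1)) ℚ := Matrix.of fun i r =>
    Fin.cases (MSVT (n + 1) lam 0 r)
      (fun i' => MSVT (n + 1) lam i'.succ r - 2 * MSVT (n + 1) lam i'.castSucc r) i
  have h1 : (MSVT (n + 1) lam).det = B.det := by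
    apply Matrix.det_eq_of_forall_row_eq_smul_add_pred (fun _ => 2)
    · intro j; simp [B]
    · intro i j; simp [B]
  rw [h1, Matrix.det_succ_column_zero, Fin.sum_univ_succ]
  rw [Finset.sum_eq_zero]
  swap
  · intro i _
    have : B i.succ 0 = 0 := by
      simp [B, MSVT, hSVT_zero_right, pow_succ]; ring
    rw [this]; simp
  have h0 : B 0 0 = 1 := by simp [B, MSVT, hSVT_zero_right]
  rw [h0]
  have h2 : B.submatrix (Fin.succAbove 0) Fin.succ = Matrix.of fun (i r : Fin n) =>
      ∑ m ∈ Icc (lam (i + 1)) (lam i), (if lam (i + 1) < m then (2 : ℚ) else 1) *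
        ((-1) ^ (r : ℕ) * hSVT i (m + (n - 1 - i)) r) := by
    ext i r
    have := hSVT_row_sum i (n - 1 - i) r (lam (i + 1)) (lam i) (hdec _ _ (by omega))
    simp only [Matrix.of_apply, mul_left_comm, ← Finset.mul_sum]
    rw [this]
    simp only [B, MSVT, Matrix.submatrix_apply, Matrix.of_apply, Fin.succAbove_zero,
      Fin.cases_succ, Fin.val_succ, Fin.val_castSucc]
    have hi := i.2
    rw [show lam i + 1 + (n - 1 - i) = lam i + (n + 1 - 1 - (i : ℕ)) by omega,
      show n + 1 - 1 - ((i : ℕ) + 1) = n - 1 - i by omega]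
    ring
  rw [h2, det_sum_rows (fun i : Fin n => Icc (lam (i + 1)) (lam i))
    (fun i m => if lam (i + 1) < m then (2 : ℚ) else 1)
    (fun i m r => (-1) ^ (r : ℕ) * hSVT i (m + (n - 1 - i)) r)]
  simp only [Fin.val_zero, pow_zero, one_mul, add_zero]
  apply sum_congr rfl
  intro k _
  congr 2
  ext i r
  simp [MSVT]

lemma prod_lt_eq {n : ℕ} (f : Fin n → Fin n → ℚ) :
    ∏ p ∈ Finset.univ.filter (fun p : Fin n × Fin n => p.1 < p.2), f p.1 p.2
      = ∏ i : Fin n, ∏ j ∈ Ioi i, f i j := by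
  rw [Finset.prod_filter, ← Finset.univ_product_univ, Finset.prod_product]
  apply prod_congr rfl
  intro i _
  rw [← Finset.prod_filter]
  apply prod_congr _ (fun _ _ => rfl)
  ext j; simp

lemma det_choose_neg {n : ℕ} (v : Fin n → ℕ) :
    (∏ j : Fin n, ((j : ℕ).factorial : ℚ)) *
      (Matrix.of fun i r : Fin n => (-1 : ℚ) ^ (r : ℕ) * ((v i).choose r : ℚ)).det
      = ∏ i : Fin n, ∏ j ∈ Ioi i, ((v i : ℚ) - v j) := by
  have h := Matrix.det_eval_matrixOfPolynomials_eq_det_vandermonde (fun i => -(v i : ℚ))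
    (fun j => ascPochhammer ℚ j) (fun i => ascPochhammer_natDegree _ _)
    (fun i => monic_ascPochhammer ℚ i)
  rw [Matrix.det_vandermonde] at h
  rw [← Matrix.det_mul_row]
  simp only [sub_neg_eq_add, neg_add_eq_sub] at h
  rw [h]
  congr 1
  ext i j
  simp only [Matrix.of_apply, ascPochhammer_eval_neg_eq_descPochhammer,
    descPochhammer_eval_eq_descFactorial, Nat.descFactorial_eq_factorial_mul_choose]
  push_cast; ring

lemma prod_factorial_eq (n : ℕ) : (∏ j : Fin n, ((j : ℕ).factorial : ℚ))
      = ∏ i : Fin n, ∏ j ∈ Ioi i, (((j : ℕ) : ℚ) - (i : ℕ)) := by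
  cases n with
  | zero => simp
  | succ n =>
    have := Matrix.det_vandermonde_id_eq_superFactorial (R := ℚ) n
    rw [Matrix.det_vandermonde] at this
    rw [this, ← Nat.prod_range_succ_factorial,
      Fin.prod_univ_eq_prod_range (fun j => ((j.factorial : ℕ) : ℚ)) (n + 1)]
    push_cast
    rfl

lemma det_choose_eq {n : ℕ} (v : Fin n → ℕ) :
      (Matrix.of fun i r : Fin n => (-1 : ℚ) ^ (r : ℕ) * ((v i).choose r : ℚ)).det
      = ∏ i : Fin n, ∏ j ∈ Ioi i, (((v i : ℚ) - v j) / (((j : ℕ) : ℚ) - (i : ℕ))) := by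
  simp only [Finset.prod_div_distrib]
  rw [← prod_factorial_eq, ← det_choose_neg, mul_div_cancel_left₀]
  exact Finset.prod_ne_zero_iff.2 fun j _ => by exact_mod_cast Nat.factorial_ne_zero _

lemma det_MSVT_eq (n : ℕ) (lam : ℕ → ℕ) :
    (MSVT n lam).det = ∑ k ∈ Fintype.piFinset (fun j : Fin n => Finset.range (j.val + 1)),
          (∏ j : Fin n, (((j.val).choose (k j) : ℚ))) *
            ∏ p ∈ Finset.univ.filter (fun p : Fin n × Fin n => p.1 < p.2),
              (((lam p.1.val : ℚ) - (lam p.2.val : ℚ) + (k p.1 : ℚ) - (k p.2 : ℚ)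
                  + (p.2.val : ℚ) - (p.1.val : ℚ))
                / ((p.2.val : ℚ) - (p.1.val : ℚ))) := by
  have e : MSVT n lam = Matrix.of fun i r : Fin n => ∑ k ∈ Finset.range (i.val + 1),
      ((i.val).choose k : ℚ) *
        ((-1) ^ (r : ℕ) * ((lam i + (n - 1 - i) + k).choose r : ℚ)) := by
    ext i r
    simp only [MSVT, Matrix.of_apply, hSVT_eq_sum, Finset.mul_sum]
    exact sum_congr rfl fun k _ => by ring
  rw [e, det_sum_rows (fun i : Fin n => Finset.range (i.val + 1))
    (fun i k => ((i.val).choose k : ℚ))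
    (fun i k r => (-1) ^ (r : ℕ) * ((lam i + (n - 1 - i) + k).choose r : ℚ))]
  apply sum_congr rfl
  intro k _
  congr 1
  rw [det_choose_eq (fun i => lam i + (n - 1 - i) + k i),
    prod_lt_eq (fun i j => (((lam i.val : ℚ) - (lam j.val : ℚ) + (k i : ℚ) - (k j : ℚ)
                  + (j.val : ℚ) - (i.val : ℚ))
                / ((j.val : ℚ) - (i.val : ℚ))))]
  refine prod_congr rfl fun i _ => prod_congr rfl fun j _ => ?_
  congr 1
  have hi := i.2
  have hj := j.2
  have a1 : ((n - 1 - i : ℕ) : ℚ) = n - 1 - i := by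
    rw [Nat.sub_sub, Nat.cast_sub (by omega)]; push_cast; ring
  have a2 : ((n - 1 - j : ℕ) : ℚ) = n - 1 - j := by
    rw [Nat.sub_sub, Nat.cast_sub (by omega)]; push_cast; ring
  push_cast [a1, a2]
  ring

lemma card_SVT_eq_det (n : ℕ) : ∀ (lam : ℕ → ℕ), (∀ i j : ℕ, i ≤ j → lam j ≤ lam i) →
    ((SVT n lam).card : ℚ) = (MSVT n lam).det := by
  induction n with
  | zero =>
    intro lam _
    have : SVT 0 lam = {∅} := by
      ext T
      rw [mem_SVT, mem_singleton]
      constructor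
      · rintro ⟨h0, -⟩
        apply Finset.eq_empty_of_forall_notMem
        rintro ⟨⟨i, j⟩, e⟩ h
        have := h0 i j e h
        omega
      · rintro rfl
        simp
    rw [this]
    simp
  | succ n ih =>
    intro lam hdec
    rw [card_SVT_succ n lam hdec, det_MSVT_succ n lam hdec]
    push_cast
    apply sum_congr rfl
    intro mu hmu
    simp only [Fintype.mem_piFinset, mem_Icc] at hmu
    rw [ih (extZ mu)]
    · rfl
    · apply antitone_nat_of_succ_le
      intro i
      by_cases h : i + 1 < n
      · have h' : i < n := by omega
        simp only [extZ, h, h', dite_true]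
        exact (hmu ⟨i + 1, h⟩).2.trans (hmu ⟨i, h'⟩).1
      · simp [extZ, h]

/-- For `n ≥ 1` and a partition `λ_1 ≥ … ≥ λ_n ≥ 0` padded with zeros
to length `n` (here `lam : ℕ → ℕ` weakly decreasing with `lam i = 0` for `i ≥ n`), the
number of set-valued tableaux of shape `λ` with entries in `{1, …, n}` is given by the
rational-number identity (indices `0`-indexed):
`|SVT(λ,n)| = Σ_{k_1=0}^{0} … Σ_{k_n=0}^{n-1} C(0,k_1) ⋯ C(n-1,k_n) ·
∏_{1≤i<j≤n} (λ_i − λ_j + k_i − k_j + j − i)/(j − i)`. -/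
theorem card_SVT_eq_sum (n : ℕ) (hn : 1 ≤ n) (lam : ℕ → ℕ)
    (hdec : ∀ i j : ℕ, i ≤ j → lam j ≤ lam i) (hpad : ∀ i : ℕ, n ≤ i → lam i = 0) :
    (((SVT n lam).card : ℚ))
      = ∑ k ∈ Fintype.piFinset (fun j : Fin n => Finset.range (j.val + 1)),
          (∏ j : Fin n, (((j.val).choose (k j) : ℚ))) *
            ∏ p ∈ Finset.univ.filter (fun p : Fin n × Fin n => p.1 < p.2),
              (((lam p.1.val : ℚ) - (lam p.2.val : ℚ) + (k p.1 : ℚ) - (k p.2 : ℚ)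
                  + (p.2.val : ℚ) - (p.1.val : ℚ))
                / ((p.2.val : ℚ) - (p.1.val : ℚ))) := by
  rw [card_SVT_eq_det n lam hdec, det_MSVT_eq]
end

section
/- Let n ≥ 1 and let λ be a partition with at most n nonzero parts. Then the signed count of set-valued tableaux of shape λ with entries in {1,…,n} equals one: Σ_{T ∈ SVT(λ, n)} (−1)^{|T| − |λ|} = 1. -/
open Finset

/-- Elements whose entry differs from the minimal possible one. -/
def badSet (T : Finset ((ℕ × ℕ) × ℕ)) : Finset ((ℕ × ℕ) × ℕ) :=
  T.filter fun x => x.2 ≠ x.1.1 + 1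

open Classical in
/-- The element to toggle: the minimal entry in the first bad box. -/
noncomputable def pivot (B : Finset ((ℕ × ℕ) × ℕ)) : (ℕ × ℕ) × ℕ :=
  if h : B.Nonempty then
    let z := (B.exists_min_image (fun x => toLex x.1) h).choose
    (z.1, z.1.1 + 1)
  else ((0, 0), 0)

/-- Toggle membership of the pivot. -/
noncomputable def toggle (T : Finset ((ℕ × ℕ) × ℕ)) : Finset ((ℕ × ℕ) × ℕ) :=
  if pivot (badSet T) ∈ T then T.erase (pivot (badSet T)) else insert (pivot (badSet T)) T

/-- The minimal tableau. -/
def minTab (n : ℕ) (lam : ℕ → ℕ) : Finset ((ℕ × ℕ) × ℕ) :=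
  (youngCells n lam).image fun p => (p, p.1 + 1)

lemma card_youngCells (n : ℕ) (lam : ℕ → ℕ) :
    (youngCells n lam).card = ∑ i ∈ Finset.range n, lam i := by
  rw [youngCells, card_biUnion]
  · simp
  · intro i _ j _ hij
    rw [Function.onFun, Finset.disjoint_left]
    rintro ⟨a, b⟩ h1 h2
    simp only [mem_product, mem_singleton] at h1 h2
    exact hij (h1.1.symm.trans h2.1)

lemma pivot_spec {B : Finset ((ℕ × ℕ) × ℕ)} (h : B.Nonempty) :
    ∃ z ∈ B, pivot B = (z.1, z.1.1 + 1) ∧ ∀ x ∈ B, toLex z.1 ≤ toLex x.1 := by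
  have hs := (B.exists_min_image (fun x => toLex x.1) h).choose_spec
  exact ⟨_, hs.1, by rw [pivot, dif_pos h], hs.2⟩

lemma badSet_toggle {T : Finset ((ℕ × ℕ) × ℕ)} (h : (badSet T).Nonempty) :
    badSet (toggle T) = badSet T := by
  obtain ⟨z, hz, hp, -⟩ := pivot_spec h
  ext x
  unfold toggle
  rw [hp]
  split_ifs with hm
  · simp only [badSet, mem_filter, mem_erase]
    constructor
    · rintro ⟨⟨_, h1⟩, h2⟩
      exact ⟨h1, h2⟩
    · rintro ⟨h1, h2⟩
      refine ⟨⟨?_, h1⟩, h2⟩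
      rintro rfl
      exact h2 rfl
  · simp only [badSet, mem_filter, mem_insert]
    constructor
    · rintro ⟨rfl | h1, h2⟩
      · exact absurd rfl h2
      · exact ⟨h1, h2⟩
    · rintro ⟨h1, h2⟩
      exact ⟨Or.inr h1, h2⟩

lemma toggle_toggle {T : Finset ((ℕ × ℕ) × ℕ)} (h : (badSet T).Nonempty) :
    toggle (toggle T) = T := by
  have hb := badSet_toggle h
  rw [toggle, hb]
  unfold toggle
  by_cases hm : pivot (badSet T) ∈ T
  · simp [hm]
  · simp [hm]

lemma mem_SVT_s10 {n : ℕ} {lam : ℕ → ℕ} {T : Finset ((ℕ × ℕ) × ℕ)} :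
    T ∈ SVT n lam ↔ (∀ x ∈ T, x.1 ∈ youngCells n lam ∧ 1 ≤ x.2 ∧ x.2 ≤ n) ∧
    (∀ p ∈ youngCells n lam, ∃ x ∈ T, x.1 = p) ∧
    (∀ x ∈ T, ∀ y ∈ T, x.1.1 = y.1.1 → x.1.2 + 1 = y.1.2 → x.2 ≤ y.2) ∧
    (∀ x ∈ T, ∀ y ∈ T, x.1.1 + 1 = y.1.1 → x.1.2 = y.1.2 → x.2 < y.2) := by
  simp only [SVT, mem_filter, mem_powerset, Finset.subset_iff, mem_product, mem_Icc]

lemma entry_ge {n : ℕ} {lam : ℕ → ℕ} (hdec : ∀ i j : ℕ, i ≤ j → lam j ≤ lam i)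
    {T : Finset ((ℕ × ℕ) × ℕ)} (hT : T ∈ SVT n lam) :
    ∀ i : ℕ, ∀ x ∈ T, x.1.1 = i → i + 1 ≤ x.2 := by
  obtain ⟨h1, h2, -, h4⟩ := mem_SVT_s10.1 hT
  intro i
  induction i with
  | zero => intro x hx _; exact (h1 x hx).2.1
  | succ i ih =>
    intro x hx hi
    have hc := mem_youngCells.1 (h1 x hx).1
    have hd := hdec i x.1.1 (by omega)
    obtain ⟨y, hy, hye⟩ := h2 (i, x.1.2) (mem_youngCells.2 ⟨by simp; omega, by simp; omega⟩)
    have := ih y hy (by rw [hye])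
    have := h4 y hy x hx (by rw [hye, hi]) (by rw [hye])
    omega

lemma toggle_mem {n : ℕ} {lam : ℕ → ℕ} (hdec : ∀ i j : ℕ, i ≤ j → lam j ≤ lam i)
    {T : Finset ((ℕ × ℕ) × ℕ)} (hT : T ∈ SVT n lam) (h : (badSet T).Nonempty) :
    toggle T ∈ SVT n lam := by
  have hge := entry_ge hdec hT
  obtain ⟨h1, h2, h3, h4⟩ := mem_SVT_s10.1 hT
  obtain ⟨z, hz, hp, hmin⟩ := pivot_spec h
  obtain ⟨hzT, hzne⟩ := mem_filter.1 hz
  have hzlt : z.1.1 + 1 < z.2 := by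
    have := hge _ z hzT rfl
    omega
  have hsmall : ∀ x ∈ T, (x.1.1 < z.1.1 ∨ x.1.1 = z.1.1 ∧ x.1.2 < z.1.2) → x.2 = x.1.1 + 1 := by
    intro x hx hlt
    by_contra hne
    have := hmin x (mem_filter.2 ⟨hx, hne⟩)
    rw [Prod.Lex.toLex_le_toLex] at this
    omega
  rw [mem_SVT_s10]
  unfold toggle
  rw [hp]
  split_ifs with hm
  · refine ⟨fun x hx => h1 x (mem_of_mem_erase hx), ?_,
      fun x hx y hy => h3 x (mem_of_mem_erase hx) y (mem_of_mem_erase hy),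
      fun x hx y hy => h4 x (mem_of_mem_erase hx) y (mem_of_mem_erase hy)⟩
    intro p hpc
    obtain ⟨x, hx, hxp⟩ := h2 p hpc
    by_cases hxe : x = (z.1, z.1.1 + 1)
    · refine ⟨z, mem_erase.2 ⟨?_, hzT⟩, ?_⟩
      · intro he
        exact hzne (congrArg Prod.snd he)
      · rw [← hxp, hxe]
    · exact ⟨x, mem_erase.2 ⟨hxe, hx⟩, hxp⟩
  · refine ⟨?_, ?_, ?_, ?_⟩
    · intro x hx
      rcases mem_insert.1 hx with rfl | hx
      · have := h1 z hzT
        exact ⟨this.1, by simp, by simp; omega⟩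
      · exact h1 x hx
    · intro p hpc
      obtain ⟨x, hx, hxp⟩ := h2 p hpc
      exact ⟨x, mem_insert_of_mem hx, hxp⟩
    · intro x hx y hy hxy hxy'
      rcases mem_insert.1 hx with rfl | hx <;> rcases mem_insert.1 hy with rfl | hy
      · exact le_rfl
      · have := h3 z hzT y hy hxy hxy'
        simp only at *
        omega
      · simp only at *
        have := hsmall x hx (by omega)
        omega
      · exact h3 x hx y hy hxy hxy'
    · intro x hx y hy hxy hxy'
      rcases mem_insert.1 hx with rfl | hx <;> rcases mem_insert.1 hy with rfl | hy
      · simp only at hxy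
        omega
      · have := h4 z hzT y hy hxy hxy'
        simp only at *
        omega
      · simp only at *
        have := hsmall x hx (by omega)
        omega
      · exact h4 x hx y hy hxy hxy'

lemma minTab_mem (n : ℕ) (lam : ℕ → ℕ) : minTab n lam ∈ SVT n lam := by
  have key : ∀ x ∈ minTab n lam, x.1 ∈ youngCells n lam ∧ x.2 = x.1.1 + 1 := by
    intro x hx
    obtain ⟨p, hp, rfl⟩ := mem_image.1 hx
    exact ⟨hp, rfl⟩
  rw [mem_SVT_s10]
  refine ⟨?_, ?_, ?_, ?_⟩
  · intro x hx
    obtain ⟨ha, hb⟩ := key x hx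
    have := (mem_youngCells.1 ha).1
    exact ⟨ha, by omega, by omega⟩
  · intro p hp
    exact ⟨(p, p.1 + 1), mem_image_of_mem _ hp, rfl⟩
  · intro x hx y hy h _
    have := (key x hx).2
    have := (key y hy).2
    omega
  · intro x hx y hy h _
    have := (key x hx).2
    have := (key y hy).2
    omega

lemma badSet_minTab (n : ℕ) (lam : ℕ → ℕ) : ¬ (badSet (minTab n lam)).Nonempty := by
  rintro ⟨x, hx⟩
  obtain ⟨h1, h2⟩ := mem_filter.1 hx
  obtain ⟨p, hp, rfl⟩ := mem_image.1 h1
  exact h2 rfl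

lemma badSet_nonempty {n : ℕ} {lam : ℕ → ℕ} {T : Finset ((ℕ × ℕ) × ℕ)}
    (hT : T ∈ SVT n lam) (hne : T ≠ minTab n lam) : (badSet T).Nonempty := by
  by_contra hemp
  obtain ⟨h1, h2, -, -⟩ := mem_SVT_s10.1 hT
  have key : ∀ x ∈ T, x.2 = x.1.1 + 1 := by
    intro x hx
    by_contra hc
    exact hemp ⟨x, mem_filter.2 ⟨hx, hc⟩⟩
  apply hne
  ext x
  constructor
  · intro hx
    exact mem_image.2 ⟨x.1, (h1 x hx).1, by rw [← key x hx]⟩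
  · intro hx
    obtain ⟨p, hp, rfl⟩ := mem_image.1 hx
    obtain ⟨y, hy, rfl⟩ := h2 p hp
    rw [← key y hy]
    exact hy

lemma card_le_of_mem {n : ℕ} {lam : ℕ → ℕ} {T : Finset ((ℕ × ℕ) × ℕ)}
    (hT : T ∈ SVT n lam) : ∑ i ∈ Finset.range n, lam i ≤ T.card := by
  rw [← card_youngCells]
  refine le_trans (card_le_card ?_) (card_image_le (s := T) (f := Prod.fst))
  intro p hp
  obtain ⟨x, hx, hxp⟩ := (mem_SVT_s10.1 hT).2.1 p hp
  exact mem_image.2 ⟨x, hx, hxp⟩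

lemma card_toggle (T : Finset ((ℕ × ℕ) × ℕ)) :
    (toggle T).card = T.card + 1 ∨ T.card = (toggle T).card + 1 := by
  unfold toggle
  split_ifs with hm
  · right
    exact (card_erase_add_one hm).symm
  · left
    exact card_insert_of_notMem hm

/-- For `n ≥ 1` and a partition `λ` with at most `n` nonzero parts
(padded with zeros to length `n`), the signed count of set-valued tableaux of shape `λ`
with entries in `{1, …, n}` equals one: `Σ_{T ∈ SVT(λ,n)} (−1)^(|T|−|λ|) = 1`,
i.e. `G_λ(1,…,1 | −1) = 1`. -/
theorem signed_count_SVT (n : ℕ) (hn : 1 ≤ n) (lam : ℕ → ℕ)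
    (hdec : ∀ i j : ℕ, i ≤ j → lam j ≤ lam i) (hpad : ∀ i : ℕ, n ≤ i → lam i = 0) :
    ∑ T ∈ SVT n lam, (-1 : ℤ) ^ (T.card - ∑ i ∈ Finset.range n, lam i) = 1 := by
  rw [← Finset.sum_erase_add _ _ (minTab_mem n lam)]
  have hc : (minTab n lam).card = ∑ i ∈ Finset.range n, lam i := by
    rw [← card_youngCells, minTab, card_image_of_injective]
    intro a b hab
    exact congrArg Prod.fst hab
  rw [hc, Nat.sub_self, pow_zero]
  have h0 : ∑ T ∈ (SVT n lam).erase (minTab n lam),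
      (-1 : ℤ) ^ (T.card - ∑ i ∈ Finset.range n, lam i) = 0 := by
    have hb : ∀ T ∈ (SVT n lam).erase (minTab n lam), (badSet T).Nonempty := fun T hT =>
      badSet_nonempty (mem_of_mem_erase hT) (ne_of_mem_erase hT)
    refine Finset.sum_involution (fun T _ => toggle T) ?_ ?_ ?_ ?_
    · intro T hT
      have hm := mem_of_mem_erase hT
      have h1 := card_le_of_mem hm
      have h2 := card_le_of_mem (toggle_mem hdec hm (hb T hT))
      rcases card_toggle T with h | h
      · rw [h, Nat.sub_add_comm h1, pow_succ]
        ring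
      · rw [h, Nat.sub_add_comm h2, pow_succ]
        ring
    · intro T hT _ he
      have := card_toggle T
      rw [he] at this
      omega
    · intro T hT
      refine mem_erase.2 ⟨?_, toggle_mem hdec (mem_of_mem_erase hT) (hb T hT)⟩
      intro he
      apply badSet_minTab n lam
      rw [← he, badSet_toggle (hb T hT)]
      exact hb T hT
    · intro T hT
      exact toggle_toggle (hb T hT)
  rw [h0, zero_add]
end

section
/- Let n ≥ 1 and let λ_1 ≥ λ_2 ≥ … ≥ λ_n ≥ 0 be integers. Then the following summation formula for Holman's hypergeometric function F^{(n)} holds, as an identity in ℚ: Σ_{k_1=0}^{0} Σ_{k_2=0}^{1} ⋯ Σ_{k_n=0}^{n−1} (−1)^{k_1 + k_2 + ⋯ + k_n} C(0, k_1) C(1, k_2) ⋯ C(n−1, k_n) · ∏_{1≤i<j≤n} (λ_i − λ_j + k_i − k_j + j − i)/(λ_i − λ_j + j − i) = ∏_{1≤i<j≤n} (j − i)/(λ_i − λ_j + j − i). Equivalently, F^{(n)} with parameter matrix A_{ij} = λ_i − λ_j + j − i (1 ≤ i < j ≤ n), numerator parameters 0, −1, …, −(n−1), denominator parameters all equal to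 1, and all arguments equal to 1, equals 1/|SST(λ,n)|, where |SST(λ,n)| = ∏_{1≤i<j≤n} (λ_i − λ_j + j − i)/(j − i) is the number of semistandard Young tableaux of shape λ with entries in {1,…,n}. -/
open Finset

theorem row_sum (j m : ℕ) (c : ℚ) :
    ∑ k ∈ Finset.range (j + 1), ((-1 : ℚ) ^ k * (j.choose k : ℚ)) * (c - k) ^ m
      = (fwdDiff (1 : ℚ))^[j] (fun r : ℚ => r ^ m) (c - j) := by
  rw [fwdDiff_iter_eq_sum_shift, ← Finset.sum_range_reflect]
  refine Finset.sum_congr rfl fun k hk => ?_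
  have hk' : k ≤ j := by simpa [Nat.lt_succ_iff] using hk
  have h1 : j + 1 - 1 - k = j - k := by omega
  rw [h1, Nat.choose_symm hk', Nat.cast_sub hk']
  simp only [zsmul_eq_mul, nsmul_eq_mul]
  push_cast
  congr 2
  ring

theorem prod_pairs (n : ℕ) (y : Fin n → ℚ) :
    ∏ p ∈ Finset.univ.filter (fun p : Fin n × Fin n => p.1 < p.2), (y p.2 - y p.1)
      = (Matrix.vandermonde y).det := by
  rw [Matrix.det_vandermonde, Finset.prod_filter, Fintype.prod_prod_type]
  refine Finset.prod_congr rfl fun i _ => ?_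
  rw [← Finset.prod_filter]
  refine Finset.prod_congr ?_ fun _ _ => rfl
  ext j
  simp

theorem sum_det (n : ℕ) (c : Fin n → ℚ) :
    ∑ k ∈ Fintype.piFinset (fun j : Fin n => Finset.range (j.val + 1)),
        (-1 : ℚ) ^ (∑ j : Fin n, k j) * (∏ j : Fin n, (((j.val).choose (k j) : ℚ))) *
          (Matrix.vandermonde (fun j => c j - (k j : ℚ))).det
      = ∏ j : Fin n, ((j.val).factorial : ℚ) := by
  set M : Matrix (Fin n) (Fin n) ℚ := Matrix.of fun j m =>
    (fwdDiff (1 : ℚ))^[j.val] (fun r : ℚ => r ^ m.val) (c j - j.val) with hM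
  have h1 : M.det = ∏ j : Fin n, ((j.val).factorial : ℚ) := by
    rw [Matrix.det_of_isUpperTriangular]
    · refine Finset.prod_congr rfl fun j _ => ?_
      simp only [hM, Matrix.of_apply]
      rw [fwdDiff_iter_eq_factorial]
      simp
    · intro i j hij
      simp only [hM, Matrix.of_apply]
      rw [fwdDiff_iter_pow_eq_zero_of_lt (by simpa using hij)]
      simp
  rw [← h1]
  have h2 : M = fun j : Fin n => ∑ k ∈ Finset.range (j.val + 1),
      (((-1 : ℚ) ^ k * (j.val.choose k : ℚ)) • (fun m : Fin n => (c j - k) ^ m.val)) := by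
    funext j m
    simp only [hM, Matrix.of_apply, ← row_sum, Finset.sum_apply, Pi.smul_apply, smul_eq_mul]
  have h3 := (Matrix.detRowAlternating (R := ℚ) (n := Fin n)).toMultilinearMap.map_sum_finset
    (fun (j : Fin n) (k : ℕ) =>
      (((-1 : ℚ) ^ k * (j.val.choose k : ℚ)) • (fun m : Fin n => (c j - k) ^ m.val)))
    (fun j : Fin n => Finset.range (j.val + 1))
  rw [← h2] at h3
  refine Eq.trans ?_ h3.symm
  refine Finset.sum_congr rfl fun k _ => ?_
  rw [MultilinearMap.map_smul_univ, Finset.prod_mul_distrib, Finset.prod_pow_eq_pow_sum]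
  rfl

theorem prod_fact (n : ℕ) :
    (Matrix.vandermonde (fun j : Fin n => (j.val : ℚ))).det
      = ∏ j : Fin n, ((j.val).factorial : ℚ) := by
  rcases n with _ | n
  · simp
  · rw [Matrix.det_vandermonde_id_eq_superFactorial, ← Nat.prod_range_factorial_succ,
      Fin.prod_univ_succ, ← Fin.prod_univ_eq_prod_range (fun x => (x+1).factorial)]
    simp

/-- For `n ≥ 1` and integers `λ_1 ≥ … ≥ λ_n ≥ 0` (here `0`-indexed),
the following terminating summation formula for Holman's hypergeometric function
`F^(n)` holds in `ℚ`:
`Σ_{k_1=0}^{0} … Σ_{k_n=0}^{n-1} (−1)^{k_1+⋯+k_n} C(0,k_1) ⋯ C(n-1,k_n) ·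
∏_{1≤i<j≤n} (λ_i − λ_j + k_i − k_j + j − i)/(λ_i − λ_j + j − i)
= ∏_{1≤i<j≤n} (j − i)/(λ_i − λ_j + j − i)`,
i.e. `F^(n)` with `A_{ij} = λ_i − λ_j + j − i`, numerator parameters `0, −1, …, −(n−1)`,
denominator parameters `1` and all arguments `1` equals `1/|SST(λ,n)|`. -/
theorem holman_summation (n : ℕ) (hn : 1 ≤ n)
    (lam : Fin n → ℕ) (hlam : ∀ i j : Fin n, i ≤ j → lam j ≤ lam i) :
    ∑ k ∈ Fintype.piFinset (fun j : Fin n => Finset.range (j.val + 1)),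
        (-1 : ℚ) ^ (∑ j : Fin n, k j) * (∏ j : Fin n, (((j.val).choose (k j) : ℚ))) *
          ∏ p ∈ Finset.univ.filter (fun p : Fin n × Fin n => p.1 < p.2),
            (((lam p.1 : ℚ) - (lam p.2 : ℚ) + (k p.1 : ℚ) - (k p.2 : ℚ)
                + (p.2.val : ℚ) - (p.1.val : ℚ))
              / ((lam p.1 : ℚ) - (lam p.2 : ℚ) + (p.2.val : ℚ) - (p.1.val : ℚ)))
      = ∏ p ∈ Finset.univ.filter (fun p : Fin n × Fin n => p.1 < p.2),
          (((p.2.val : ℚ) - (p.1.val : ℚ))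
            / ((lam p.1 : ℚ) - (lam p.2 : ℚ) + (p.2.val : ℚ) - (p.1.val : ℚ))) := by
  have hR := (prod_pairs n (fun j => (j.val : ℚ))).trans (prod_fact n)
  simp only [Finset.prod_div_distrib] at hR ⊢
  rw [hR, ← sum_det n (fun j => (j.val : ℚ) - lam j), Finset.sum_div]
  refine Finset.sum_congr rfl fun k _ => ?_
  rw [← prod_pairs, mul_div_assoc]
  congr 2
  refine Finset.prod_congr rfl fun p _ => ?_
  ring
end
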